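/- For every m ∈ ℕ, the Hochschild cohomology HH^m(S_q(V), A_g) := Ext^m_{A^e}(A, A_g) is isomorphic as a k-vector space to the free k-vector space on the set { (α, β) ∈ ℕ^N × {0,1}^N : |β| = m and α − β ∈ C_g }; that is, HH^m(S_q(V), A_g) ≅ ⊕_{β ∈ {0,1}^N, |β| = m} ⊕_{α ∈ ℕ^N, α−β ∈ C_g} span_k{ x^α # g ⊗ (x*)^{∧β} }. In particular it vanishes for m > N. -/

import Mathlib

attribute [local instance] Classical.propDecidable

set_option synthInstance.maxHeartbeats 1000000
set_option maxHeartbeats 1000000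

noncomputable section

open scoped TensorProduct
open CategoryTheory

section QSA
variable (k : Type) [Field k] (N : ℕ) (q : Fin N → Fin N → k)

inductive QRel : FreeAlgebra k (Fin N) → FreeAlgebra k (Fin N) → Prop
  | rel (i j : Fin N) : QRel (FreeAlgebra.ι k i * FreeAlgebra.ι k j)
      (q i j • (FreeAlgebra.ι k j * FreeAlgebra.ι k i))

abbrev QSA := RingQuot (QRel k N q)

def X (i : Fin N) : QSA k N q := RingQuot.mkAlgHom k (QRel k N q) (FreeAlgebra.ι k i)

abbrev QSAe := QSA k N q ⊗[k] (QSA k N q)ᵐᵒᵖ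

instance : Module (QSAe k N q) (QSA k N q) := TensorProduct.Algebra.module

variable (lam : Fin N → k)

/-- The diagonal algebra automorphism `g` of `S_q(V)` with `g(x_i) = λ_i x_i`. -/
def gAlg : QSA k N q →ₐ[k] QSA k N q :=
  RingQuot.liftAlgHom k
    ⟨FreeAlgebra.lift k (fun i => lam i • X k N q i), by
      intro x y h
      induction h with
      | rel i j =>
        have hrel : (X k N q i) * (X k N q j) = q i j • ((X k N q j) * (X k N q i)) := by
          simpa only [X, map_mul, map_smul] using
            RingQuot.mkAlgHom_rel k (QRel.rel (k := k) (N := N) (q := q) i j)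
        simp only [map_mul, map_smul, FreeAlgebra.lift_ι_apply]
        rw [smul_mul_smul_comm, hrel, smul_smul]
        rw [smul_mul_smul_comm, smul_smul]
        congr 1
        ring⟩

/-- The algebra endomorphism `a ⊗ b^{op} ↦ a ⊗ (g b)^{op}` of `A^e`. -/
def taug : QSAe k N q →ₐ[k] QSAe k N q :=
  Algebra.TensorProduct.map (AlgHom.id k (QSA k N q)) (AlgHom.op (gAlg k N q lam))

/-- The twisted bimodule `A_g`: as a vector space it is `A`, with `A^e`-action
`(a ⊗ b^{op}) · c = a c g(b)`. -/
def Ag (lam : Fin N → k) : Type := QSA k N q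

instance : AddCommGroup (Ag k N q lam) := inferInstanceAs (AddCommGroup (QSA k N q))

instance : Module (QSAe k N q) (Ag k N q lam) :=
  Module.compHom (QSA k N q) (taug k N q lam).toRingHom

end QSA


section CgDef
variable (k : Type) [Field k] (N : ℕ) (q : Fin N → Fin N → k) (lam : Fin N → k)

/-- A subset `β ⊆ {1,…,N}`, considered as a `{0,1}`-vector in `ℤ^N`. -/
def betaZ (S : Finset (Fin N)) : Fin N → ℤ := fun s => if s ∈ S then 1 else 0

/-- The set `C_g = {γ ∈ (ℕ ∪ {-1})^N : for each i, ∏_s q_{i,s}^{γ_s} = λ_i or γ_i = -1}`. -/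
def Cg : Set (Fin N → ℤ) :=
  {γ | ∀ i : Fin N, (∏ s, q i s ^ γ s) = lam i ∨ γ i = -1}

/-- The Hochschild cohomology `HH^m(S_q(V), A_g) = Ext^m_{A^e}(A, A_g)`, as a
`k`-vector space (`Ext` taken in the category of left `A^e`-modules). -/
def HHg (m : ℕ) : ModuleCat k :=
  ((Ext k (ModuleCat (QSAe k N q)) m).obj
    (Opposite.op (ModuleCat.of (QSAe k N q) (QSA k N q)))).obj
    (ModuleCat.of (QSAe k N q) (Ag k N q lam))

end CgDef


section AbstractExt

lemma sc_homology_equiv {k : Type} [Field k] (S : ShortComplex (ModuleCat.{0} k))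
    (G : Type) [AddCommGroup G] [Module k G] (p : S.X₂ →ₗ[k] G)
    (hs : ∀ g, ∃ x, S.g x = 0 ∧ p x = g)
    (hk : ∀ x, S.g x = 0 → (p x = 0 ↔ ∃ y, S.f y = x)) :
    Nonempty (S.homology ≃ₗ[k] G) := by
  let p' : LinearMap.ker S.g.hom →ₗ[k] G := p ∘ₗ (LinearMap.ker S.g.hom).subtype
  have hp' : Function.Surjective p' := fun g => by
    obtain ⟨x, hx, hg⟩ := hs g
    exact ⟨⟨x, hx⟩, hg⟩
  have hker : LinearMap.range S.moduleCatToCycles = LinearMap.ker p' := by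
    ext ⟨x, hx⟩
    rw [LinearMap.mem_ker, LinearMap.mem_range]
    refine Iff.trans ?_ (hk x hx).symm
    constructor
    · rintro ⟨y, hy⟩
      exact ⟨y, congrArg Subtype.val hy⟩
    · rintro ⟨y, hy⟩
      exact ⟨y, Subtype.ext hy⟩
  exact ⟨S.moduleCatHomologyIso.toLinearEquiv.trans
    ((Submodule.quotEquivOfEq _ _ hker).trans (p'.quotKerEquivOfSurjective hp'))⟩

variable {k : Type} [Field k] {E : Type} [Ring E] [Algebra k E]
  (K : ℕ → Type) [∀ n, AddCommGroup (K n)] [∀ n, Module E (K n)]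
  (d : ∀ n, K (n + 1) →ₗ[E] K n)

/-- Coboundaries in the Hom complex. -/
def IsCob (Y : Type) [AddCommGroup Y] [Module E Y] : (m : ℕ) → (K m →ₗ[E] Y) → Prop
  | 0, φ => φ = 0
  | n + 1, φ => ∃ ψ : K n →ₗ[E] Y, φ = ψ ∘ₗ d n

/-- The chain complex. -/
def absComplex (hdd : ∀ n, d n ∘ₗ d (n + 1) = 0) : ChainComplex (ModuleCat.{0} E) ℕ :=
  ChainComplex.of (fun n => ModuleCat.of E (K n)) (fun n => ModuleCat.ofHom (d n))
    (fun n => by rw [← ModuleCat.ofHom_comp, hdd]; rfl)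

lemma absComplex_d (hdd : ∀ n, d n ∘ₗ d (n + 1) = 0) (n : ℕ) :
    (absComplex K d hdd).d (n + 1) n = ModuleCat.ofHom (d n) :=
  ChainComplex.of_d (X := fun n => ModuleCat.of E (K n)) (fun n => ModuleCat.ofHom (d n)) n

variable {Z : Type} [AddCommGroup Z] [Module E Z]

/-- The projective resolution. -/
def absRes [∀ n, Module.Projective E (K n)] (hdd : ∀ n, d n ∘ₗ d (n + 1) = 0)
    (ε : K 0 →ₗ[E] Z) (hε : Function.Surjective ε)
    (hε0 : ε ∘ₗ d 0 = 0) (hex0 : ∀ x, ε x = 0 → ∃ y, d 0 y = x)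
    (hexn : ∀ n x, d n x = 0 → ∃ y, d (n + 1) y = x) :
    ProjectiveResolution (ModuleCat.of E Z) where
  complex := absComplex K d hdd
  projective n := (IsProjective.iff_projective (R := E) (K n)).1 inferInstance
  π := (ChainComplex.toSingle₀Equiv _ _).symm ⟨ModuleCat.ofHom ε, by
    rw [absComplex_d]
    exact (ModuleCat.ofHom_comp _ _).symm.trans (by rw [hε0]; rfl)⟩
  quasiIso := ⟨fun n => by
    cases n with
    | zero =>
      rw [ChainComplex.quasiIsoAt₀_iff, ShortComplex.quasiIso_iff_of_zeros' _ rfl rfl rfl]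
      constructor
      · rw [ShortComplex.moduleCat_exact_iff]
        intro x hx
        obtain ⟨y, hy⟩ := hex0 x hx
        refine ⟨y, ?_⟩
        refine Eq.trans ?_ hy
        exact congrArg (fun f => (ModuleCat.Hom.hom f) y) (absComplex_d K d hdd 0)
      · rw [ModuleCat.epi_iff_surjective]
        exact hε
    | succ m =>
      rw [quasiIsoAt_iff_exactAt' (hL := ChainComplex.exactAt_succ_single_obj ..),
          HomologicalComplex.exactAt_iff' _ (m + 2) (m + 1) m (by simp) (by simp)]
      rw [ShortComplex.moduleCat_exact_iff]
      intro x hx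
      obtain ⟨y, hy⟩ := hexn m x (by
        refine Eq.trans ?_ hx
        exact congrArg (fun f => (ModuleCat.Hom.hom f) x) (absComplex_d K d hdd m).symm)
      refine ⟨y, ?_⟩
      refine Eq.trans ?_ hy
      exact congrArg (fun f => (ModuleCat.Hom.hom f) y) (absComplex_d K d hdd (m + 1))⟩

theorem absExt [∀ n, Module.Projective E (K n)] (hdd : ∀ n, d n ∘ₗ d (n + 1) = 0)
    (ε : K 0 →ₗ[E] Z) (hε : Function.Surjective ε)
    (hε0 : ε ∘ₗ d 0 = 0) (hex0 : ∀ x, ε x = 0 → ∃ y, d 0 y = x)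
    (hexn : ∀ n x, d n x = 0 → ∃ y, d (n + 1) y = x)
    (Y : Type) [AddCommGroup Y] [Module E Y] (m : ℕ)
    (G : Type) [AddCommGroup G] [Module k G] (P : (K m →ₗ[E] Y) → G)
    (hPadd : ∀ φ ψ, P (φ + ψ) = P φ + P ψ)
    (hPsmul : ∀ (c : k) (φ ψ : K m →ₗ[E] Y), (∀ x, ψ x = algebraMap k E c • φ x) → P ψ = c • P φ)
    (hsurj : ∀ g, ∃ φ, φ ∘ₗ d m = 0 ∧ P φ = g)
    (hker : ∀ φ, φ ∘ₗ d m = 0 → (P φ = 0 ↔ IsCob K d Y m φ)) :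
    Nonempty ((((Ext k (ModuleCat.{0} E) m).obj
    (Opposite.op (ModuleCat.of E Z))).obj (ModuleCat.of E Y)) ≃ₗ[k] G) := by
  let R := absRes K d hdd ε hε hε0 hex0 hexn
  let C := R.complex.linearYonedaObj k (ModuleCat.of E Y)
  have e1 := (R.isoExt (R := k) m (ModuleCat.of E Y)).toLinearEquiv
  suffices h : Nonempty (C.homology m ≃ₗ[k] G) from ⟨e1.trans h.some⟩
  let p : C.X m →ₗ[k] G :=
    { toFun := fun f => P (ModuleCat.Hom.hom (show ModuleCat.of E (K m) ⟶ ModuleCat.of E Y from f))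
      map_add' := fun f g => hPadd _ _
      map_smul' := fun c f => hPsmul c _ _ (fun x => rfl) }
  have hd : ∀ n (f : ModuleCat.of E (K n) ⟶ ModuleCat.of E Y),
      (show ModuleCat.of E (K (n + 1)) ⟶ ModuleCat.of E Y from C.d n (n + 1) f) =
        ModuleCat.ofHom (f.hom ∘ₗ d n) := by
    intro n f
    have : C.d n (n + 1) f = R.complex.d (n + 1) n ≫ f := rfl
    refine this.trans ?_
    have h2 : R.complex.d (n + 1) n = ModuleCat.ofHom (d n) := absComplex_d K d hdd n
    rw [h2]
    rfl
  have main : ∀ i, (ComplexShape.up ℕ).prev m = i →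
      (∀ f : C.X m, (∃ y, C.d i m y = f) ↔
        IsCob K d Y m (ModuleCat.Hom.hom
          (show ModuleCat.of E (K m) ⟶ ModuleCat.of E Y from f))) →
      Nonempty (C.homology m ≃ₗ[k] G) := by
    intro i hi hcob
    have e3 := (ShortComplex.homologyMapIso (C.isoSc' i m (m + 1) hi (by simp))).toLinearEquiv
    suffices h : Nonempty ((C.sc' i m (m + 1)).homology ≃ₗ[k] G) from
      ⟨LinearEquiv.trans e3 h.some⟩
    have hz : ∀ f : C.X m, C.d m (m + 1) f = 0 ↔ (ModuleCat.Hom.hom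
          (show ModuleCat.of E (K m) ⟶ ModuleCat.of E Y from f)) ∘ₗ d m = 0 := by
      intro f
      have := hd m f
      constructor
      · intro h
        have h' := this.symm.trans h
        exact congrArg ModuleCat.Hom.hom h'
      · intro h
        refine this.trans ?_
        rw [h]
        rfl
    apply sc_homology_equiv _ G p
    · intro g
      obtain ⟨φ, h1, h2⟩ := hsurj g
      exact ⟨ModuleCat.ofHom φ, (hz (ModuleCat.ofHom φ)).2 h1, h2⟩
    · intro x hx
      refine (hker _ ((hz x).1 hx)).trans (hcob x).symm
  cases m with
  | zero =>
    refine main 0 (by simp) ?_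
    intro f
    have h0 : C.d 0 0 = 0 := C.shape _ _ (by simp)
    rw [h0]
    constructor
    · rintro ⟨y, rfl⟩
      rfl
    · intro h
      refine ⟨0, ?_⟩
      have : f = (show ModuleCat.of E (K 0) ⟶ ModuleCat.of E Y from 0) := ModuleCat.hom_ext h
      rw [this]
      rfl
  | succ n =>
    refine main n (by simp) ?_
    intro f
    constructor
    · rintro ⟨y, rfl⟩
      exact ⟨ModuleCat.Hom.hom (show ModuleCat.of E (K n) ⟶ ModuleCat.of E Y from y),
        congrArg ModuleCat.Hom.hom (hd n y)⟩
    · rintro ⟨ψ, hψ⟩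
      refine ⟨ModuleCat.ofHom ψ, ?_⟩
      refine (hd n (ModuleCat.ofHom ψ)).trans ?_
      refine ModuleCat.hom_ext ?_
      exact hψ.symm
end AbstractExt

section KoszulComb
variable {N : ℕ}

/-- Koszul sign. -/
def sg (i : Fin N) (S : Finset (Fin N)) : ℤ := (-1) ^ (S.filter (fun j => j < i)).card

lemma sg_insert {i : Fin N} {S : Finset (Fin N)} (h : i ∉ S) (j : Fin N) :
    sg j (insert i S) = (if i < j then -1 else 1) * sg j S := by
  unfold sg
  rw [Finset.filter_insert]
  split_ifs with hij
  · rw [Finset.card_insert_of_notMem (by simp [h]), pow_succ]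
    ring
  · simp

lemma sg_insert_self {i : Fin N} {S : Finset (Fin N)} (h : i ∉ S) :
    sg i (insert i S) = sg i S := by
  rw [sg_insert h]; simp

lemma sg_mul_self (i : Fin N) (S : Finset (Fin N)) : sg i S * sg i S = 1 := by
  unfold sg
  rw [← pow_add, ← two_mul, pow_mul]; simp

lemma sg_anti {i j : Fin N} (hij : i ≠ j) {T : Finset (Fin N)} (hi : i ∉ T) (hj : j ∉ T) :
    sg i T * sg j (insert i T) + sg j T * sg i (insert j T) = 0 := by
  rw [sg_insert hi, sg_insert hj]
  rcases lt_or_gt_of_ne hij with h | h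
  · rw [if_pos h, if_neg h.not_gt]; ring
  · rw [if_pos h, if_neg h.not_gt]; ring

lemma sg_anti' {i j : Fin N} (hij : i ≠ j) {T : Finset (Fin N)} (hi : i ∉ T) (hj : j ∉ T) :
    sg i (insert j T) * sg j (insert i (insert j T)) + sg j (insert j T) * sg i T = 0 := by
  have hi' : i ∉ insert j T := by simp [hij, hi]
  rw [sg_insert hi', sg_insert_self hj, sg_insert hj]
  rcases lt_or_gt_of_ne hij with h | h
  · rw [if_pos h, if_neg h.not_gt]; ring
  · rw [if_pos h, if_neg h.not_gt]; ring

variable {R : Type*} [Ring R] {M : Type*} [AddCommGroup M] [Module R M]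

/-- Lowering Koszul differential. -/
def kD (f : Fin N → Finset (Fin N) → M →ₗ[R] M) :
    (Finset (Fin N) → M) →ₗ[R] (Finset (Fin N) → M) :=
  LinearMap.pi fun T => ∑ i ∈ Tᶜ, sg i T • ((f i T) ∘ₗ LinearMap.proj (insert i T))

/-- Raising Koszul differential. -/
def kH (h : Fin N → Finset (Fin N) → M →ₗ[R] M) :
    (Finset (Fin N) → M) →ₗ[R] (Finset (Fin N) → M) :=
  LinearMap.pi fun S => ∑ i ∈ S, sg i S • ((h i (S.erase i)) ∘ₗ LinearMap.proj (S.erase i))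

lemma kD_apply (f : Fin N → Finset (Fin N) → M →ₗ[R] M) (x : Finset (Fin N) → M)
    (T : Finset (Fin N)) : kD f x T = ∑ i ∈ Tᶜ, sg i T • f i T (x (insert i T)) := by
  simp [kD]

lemma kH_apply (f : Fin N → Finset (Fin N) → M →ₗ[R] M) (x : Finset (Fin N) → M)
    (S : Finset (Fin N)) : kH f x S = ∑ i ∈ S, sg i S • f i (S.erase i) (x (S.erase i)) := by
  simp [kH]

lemma kD_kD (f : Fin N → Finset (Fin N) → M →ₗ[R] M)
    (hf : ∀ T i j, i ≠ j → i ∉ T → j ∉ T → ∀ m,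
      f i T (f j (insert i T) m) = f j T (f i (insert j T) m))
    (x : Finset (Fin N) → M) : kD f (kD f x) = 0 := by
  ext T
  rw [kD_apply]
  simp only [kD_apply, map_sum, Finset.smul_sum, map_zsmul, smul_smul]
  rw [Finset.sum_sigma']
  refine Finset.sum_involution (fun p _ => ⟨p.2, p.1⟩) ?_ ?_ ?_ ?_
  · rintro ⟨i, j⟩ h
    simp only [Finset.mem_sigma, Finset.mem_compl, Finset.mem_insert, not_or] at h
    obtain ⟨hi, hji, hj⟩ := h
    dsimp only
    rw [Finset.insert_comm j i T, hf T i j (Ne.symm hji) hi hj, ← add_smul,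
      sg_anti (Ne.symm hji) hi hj, zero_smul]
  · rintro ⟨i, j⟩ h _ h2
    simp only [Finset.mem_sigma, Finset.mem_compl, Finset.mem_insert, not_or] at h
    simp only [Sigma.mk.injEq] at h2
    exact h.2.1 h2.1
  · rintro ⟨i, j⟩ h
    simp only [Finset.mem_sigma, Finset.mem_compl, Finset.mem_insert, not_or] at h ⊢
    exact ⟨h.2.2, Ne.symm h.2.1, h.1⟩
  · rintro ⟨i, j⟩ h
    rfl

lemma kD_kH (f h : Fin N → Finset (Fin N) → M →ₗ[R] M)
    (hfh : ∀ T i j, i ≠ j → i ∉ T → j ∉ T → ∀ m,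
      f i (insert j T) (h j (insert i T) m) = h j T (f i T m))
    (x : Finset (Fin N) → M) (S : Finset (Fin N)) :
    kD f (kH h x) S + kH h (kD f x) S =
      ∑ i ∈ Sᶜ, f i S (h i S (x S)) + ∑ i ∈ S, h i (S.erase i) (f i (S.erase i) (x S)) := by
  have h1 : kD f (kH h x) S = ∑ i ∈ Sᶜ, f i S (h i S (x S)) +
      ∑ i ∈ Sᶜ, ∑ j ∈ S, (sg i S * sg j (insert i S)) •
        f i S (h j ((insert i S).erase j) (x ((insert i S).erase j))) := by
    rw [kD_apply, ← Finset.sum_add_distrib]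
    refine Finset.sum_congr rfl fun i hi => ?_
    rw [Finset.mem_compl] at hi
    rw [kH_apply, Finset.sum_insert hi, Finset.erase_insert hi, map_add, smul_add, map_zsmul,
      smul_smul, sg_insert_self hi, sg_mul_self, one_smul]
    simp only [map_sum, map_zsmul, Finset.smul_sum, smul_smul]
  have h2 : kH h (kD f x) S = ∑ i ∈ S, h i (S.erase i) (f i (S.erase i) (x S)) +
      ∑ j ∈ S, ∑ i ∈ Sᶜ, (sg j S * sg i (S.erase j)) •
        h j (S.erase j) (f i (S.erase j) (x (insert i (S.erase j)))) := by
    rw [kH_apply, ← Finset.sum_add_distrib]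
    refine Finset.sum_congr rfl fun j hj => ?_
    have : (S.erase j)ᶜ = insert j Sᶜ := by
      ext a; simp only [Finset.mem_compl, Finset.mem_erase, Finset.mem_insert]; tauto
    have h3 : sg j (S.erase j) = sg j S := by
      conv_rhs => rw [← Finset.insert_erase hj]
      rw [sg_insert_self (Finset.notMem_erase j S)]
    rw [kD_apply, this, Finset.sum_insert (by simpa using hj), Finset.insert_erase hj, map_add,
      smul_add, map_zsmul, smul_smul, h3, sg_mul_self, one_smul]
    simp only [map_sum, map_zsmul, Finset.smul_sum, smul_smul]
  rw [h1, h2, Finset.sum_comm (s := S) (t := Sᶜ)]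
  have h4 : ∀ i ∈ Sᶜ, ∀ j ∈ S, (sg i S * sg j (insert i S)) •
        f i S (h j ((insert i S).erase j) (x ((insert i S).erase j))) +
        (sg j S * sg i (S.erase j)) •
        h j (S.erase j) (f i (S.erase j) (x (insert i (S.erase j)))) = 0 := by
    intro i hi j hj
    rw [Finset.mem_compl] at hi
    obtain ⟨T, hT, rfl⟩ : ∃ T, j ∉ T ∧ S = insert j T :=
      ⟨S.erase j, Finset.notMem_erase j S, (Finset.insert_erase hj).symm⟩
    have hij : i ≠ j := by rintro rfl; exact hi hj
    have hiT : i ∉ T := fun h => hi (Finset.mem_insert_of_mem h)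
    have e1 : (insert i (insert j T)).erase j = insert i T := by
      rw [Finset.insert_comm, Finset.erase_insert]
      simp [hT, Ne.symm hij]
    rw [e1, Finset.erase_insert hT, hfh T i j hij hiT hT, ← add_smul, sg_anti' hij hiT hT,
      zero_smul]
  have h5 : (∑ i ∈ Sᶜ, ∑ j ∈ S, (sg i S * sg j (insert i S)) •
        f i S (h j ((insert i S).erase j) (x ((insert i S).erase j)))) +
      (∑ i ∈ Sᶜ, ∑ j ∈ S, (sg j S * sg i (S.erase j)) •
        h j (S.erase j) (f i (S.erase j) (x (insert i (S.erase j))))) = 0 := by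
    rw [← Finset.sum_add_distrib]
    refine Finset.sum_eq_zero fun i hi => ?_
    rw [← Finset.sum_add_distrib]
    exact Finset.sum_eq_zero fun j hj => h4 i hi j hj
  rw [add_add_add_comm, h5, add_zero]

/-- Subsets of cardinality `n`. -/
abbrev SubN (N n : ℕ) : Type := {S : Finset (Fin N) // S.card = n}

variable (R M N) in
/-- Extension by zero. -/
def kExt (n : ℕ) : (SubN N n → M) →ₗ[R] (Finset (Fin N) → M) :=
  LinearMap.pi fun S => if h : S.card = n then LinearMap.proj ⟨S, h⟩ else 0

variable (R M N) in
/-- Restriction. -/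
def kRes (n : ℕ) : (Finset (Fin N) → M) →ₗ[R] (SubN N n → M) :=
  LinearMap.pi fun S => LinearMap.proj S.1

lemma kRes_apply (n : ℕ) (x : Finset (Fin N) → M) (S : SubN N n) : kRes N R M n x S = x S.1 := rfl

lemma kExt_apply (n : ℕ) (x : SubN N n → M) {S : Finset (Fin N)} (h : S.card = n) :
    kExt N R M n x S = x ⟨S, h⟩ := by
  simp [kExt, h]

lemma kExt_apply_ne (n : ℕ) (x : SubN N n → M) {S : Finset (Fin N)} (h : S.card ≠ n) :
    kExt N R M n x S = 0 := by
  simp [kExt, h]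

lemma kRes_kExt (n : ℕ) (x : SubN N n → M) : kRes N R M n (kExt N R M n x) = x := by
  ext S
  rw [kRes_apply, kExt_apply n x S.2]

/-- Graded lowering differential. -/
def dK (f : Fin N → Finset (Fin N) → M →ₗ[R] M) (n : ℕ) :
    (SubN N (n + 1) → M) →ₗ[R] (SubN N n → M) :=
  kRes N R M n ∘ₗ kD f ∘ₗ kExt N R M (n + 1)

/-- Graded raising differential. -/
def cK (f : Fin N → Finset (Fin N) → M →ₗ[R] M) (n : ℕ) :
    (SubN N n → M) →ₗ[R] (SubN N (n + 1) → M) :=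
  kRes N R M (n + 1) ∘ₗ kH f ∘ₗ kExt N R M n

lemma kExt_dK (f : Fin N → Finset (Fin N) → M →ₗ[R] M) (n : ℕ) (x : SubN N (n + 1) → M) :
    kExt N R M n (dK f n x) = kD f (kExt N R M (n + 1) x) := by
  ext T
  by_cases h : T.card = n
  · rw [kExt_apply _ _ h]; rfl
  · rw [kExt_apply_ne _ _ h, kD_apply]
    refine (Finset.sum_eq_zero fun i hi => ?_).symm
    rw [Finset.mem_compl] at hi
    rw [kExt_apply_ne, map_zero, smul_zero]
    rw [Finset.card_insert_of_notMem hi]; omega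

lemma kExt_cK (f : Fin N → Finset (Fin N) → M →ₗ[R] M) (n : ℕ) (x : SubN N n → M) :
    kExt N R M (n + 1) (cK f n x) = kH f (kExt N R M n x) := by
  ext T
  by_cases h : T.card = n + 1
  · rw [kExt_apply _ _ h]; rfl
  · rw [kExt_apply_ne _ _ h, kH_apply]
    refine (Finset.sum_eq_zero fun i hi => ?_).symm
    rw [kExt_apply_ne, map_zero, smul_zero]
    have := Finset.card_erase_add_one hi; omega

lemma kRes_kD (f : Fin N → Finset (Fin N) → M →ₗ[R] M) (n : ℕ) (x : Finset (Fin N) → M) :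
    kRes N R M n (kD f x) = dK f n (kRes N R M (n + 1) x) := by
  ext ⟨T, hT⟩
  rw [kRes_apply, dK, LinearMap.comp_apply, LinearMap.comp_apply, kRes_apply, kD_apply, kD_apply]
  refine Finset.sum_congr rfl fun i hi => ?_
  rw [Finset.mem_compl] at hi
  rw [kExt_apply _ _ (by rw [Finset.card_insert_of_notMem hi, hT])]
  rfl

lemma kRes_kH (f : Fin N → Finset (Fin N) → M →ₗ[R] M) (n : ℕ) (x : Finset (Fin N) → M) :
    kRes N R M (n + 1) (kH f x) = cK f n (kRes N R M n x) := by
  ext ⟨T, hT⟩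
  rw [kRes_apply, cK, LinearMap.comp_apply, LinearMap.comp_apply, kRes_apply, kH_apply, kH_apply]
  refine Finset.sum_congr rfl fun i hi => ?_
  rw [kExt_apply _ _ (by have := Finset.card_erase_add_one hi; dsimp only at this ⊢; omega)]
  rfl

end KoszulComb

section Models
variable {k : Type} [Field k] {N : ℕ}

/-- Weighted shift operator. -/
def wop {I : Type} (τ : I → I) (w : I → k) : (I →₀ k) →ₗ[k] (I →₀ k) :=
  Finsupp.linearCombination k (fun a => Finsupp.single (τ a) (w a))

lemma wop_single {I : Type} (τ : I → I) (w : I → k) (a : I) (r : k) :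
    wop τ w (Finsupp.single a r) = Finsupp.single (τ a) (r * w a) := by
  simp [wop]

lemma wop_apply_eq_zero {I : Type} (τ : I → I) (w : I → k) (m : I →₀ k) (a : I)
    (h : ∀ b, τ b = a → w b = 0) : wop τ w m a = 0 := by
  induction m using Finsupp.induction_linear with
  | zero => simp
  | add f g hf hg => simp [hf, hg]
  | single b r =>
    rw [wop_single, Finsupp.single_apply]
    split_ifs with hb
    · rw [h b hb, mul_zero]
    · rfl

lemma wop_eq_zero {I : Type} (τ : I → I) (w : I → k) (m : I →₀ k)
    (h : ∀ b, m b ≠ 0 → w b = 0) : wop τ w m = 0 := by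
  rw [wop, Finsupp.linearCombination_apply, Finsupp.sum]
  refine Finset.sum_eq_zero fun b hb => ?_
  rw [h b (by simpa using hb)]; simp

lemma wop_id_apply {I : Type} (w : I → k) (m : I →₀ k) (a : I) :
    wop id w m a = m a * w a := by
  induction m using Finsupp.induction_linear with
  | zero => simp
  | add f g hf hg => simp [hf, hg, add_mul]
  | single b r =>
    rw [wop_single, Finsupp.single_apply, Finsupp.single_apply]
    simp only [id]
    split_ifs with hb
    · rw [hb]
    · simp

/-- Selection of an index. -/
def sel (p : Fin N → Prop) : Option (Fin N) := if h : ∃ i, p i then some h.choose else none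

lemma sel_spec {p : Fin N → Prop} {i : Fin N} (h : sel p = some i) : p i := by
  unfold sel at h
  split_ifs at h with h'
  have := h'.choose_spec
  simp only [Option.some.injEq] at h
  rwa [h] at this

lemma sel_sum {V : Type} [AddCommMonoid V] (p : Fin N → Prop) (v : V) :
    ∑ i, (if sel p = some i then v else 0) = if ∃ i, p i then v else 0 := by
  unfold sel
  by_cases h : ∃ i, p i
  · simp only [dif_pos h, if_pos h]; simp
  · simp only [dif_neg h, if_neg h]; simp

/-- Unit exponent vector. -/
abbrev e1 (i : Fin N) : Fin N →₀ ℕ := Finsupp.single i 1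

lemma e1_apply (i j : Fin N) : e1 i j = if j = i then 1 else 0 := by
  rw [e1, Finsupp.single_apply]
  simp only [eq_comm]

lemma betaZ_insert {T : Finset (Fin N)} {i : Fin N} (h : i ∉ T) (s : Fin N) :
    betaZ N (insert i T) s = betaZ N T s + (e1 i s : ℤ) := by
  rw [e1_apply]
  unfold betaZ
  by_cases hs : s = i
  · subst hs; simp [h]
  · simp [hs]

/-! Model for the resolution -/

/-- Degree. -/
def gam1 (T : Finset (Fin N)) (c : Fin N →₀ ℕ) : Fin N → ℤ := fun s => (c s : ℤ) + betaZ N T s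

/-- Index type of the polynomial model. -/
abbrev PI (N : ℕ) : Type := (Fin N →₀ ℕ) × (Fin N →₀ ℕ)

variable (k) in
/-- Multiplication by `z_i`. -/
def f1 (i : Fin N) (_T : Finset (Fin N)) : (PI N →₀ k) →ₗ[k] (PI N →₀ k) :=
  wop (fun p => (p.1 + e1 i, p.2)) (fun _ => 1)

variable (k) in
/-- Division by `z_i`. -/
def h1 (i : Fin N) (T : Finset (Fin N)) : (PI N →₀ k) →ₗ[k] (PI N →₀ k) :=
  wop (fun p => (p.1 - e1 i, p.2)) (fun p => if sel (fun s => gam1 T p.1 s ≠ 0) = some i then 1 else 0)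

lemma gam1_insert {T : Finset (Fin N)} {i : Fin N} (h : i ∉ T) (c : Fin N →₀ ℕ) :
    gam1 (insert i T) c = gam1 T (c + e1 i) := by
  ext s
  simp only [gam1, betaZ_insert h, Finsupp.add_apply]
  push_cast
  ring

lemma f1_h1 (T : Finset (Fin N)) (i j : Fin N) (hij : i ≠ j) (hi : i ∉ T) (_hj : j ∉ T)
    (m : PI N →₀ k) :
    f1 k i (insert j T) (h1 k j (insert i T) m) = h1 k j T (f1 k i T m) := by
  induction m using Finsupp.induction_linear with
  | zero => simp
  | add f g hf hg => simp [hf, hg]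
  | single p r =>
    simp only [f1, h1, wop_single, gam1_insert hi, mul_one]
    congr 2
    ext s
    simp only [Finsupp.add_apply, Finsupp.tsub_apply, e1_apply]
    split_ifs <;> omega

lemma sum1 (S : Finset (Fin N)) (m : PI N →₀ k) :
    ∑ i ∈ Sᶜ, f1 k i S (h1 k i S m) + ∑ i ∈ S, h1 k i (S.erase i) (f1 k i (S.erase i) m) =
      wop id (fun p => if ∃ s, gam1 S p.1 s ≠ 0 then 1 else 0) m := by
  induction m using Finsupp.induction_linear with
  | zero => simp
  | add f g hf hg =>
    simp only [map_add, Finset.sum_add_distrib]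
    rw [← hf, ← hg]; abel
  | single p r =>
    have a1 : ∀ i ∈ Sᶜ, f1 k i S (h1 k i S (Finsupp.single p r)) =
        if sel (fun s => gam1 S p.1 s ≠ 0) = some i then Finsupp.single p r else 0 := by
      intro i hi
      rw [Finset.mem_compl] at hi
      simp only [f1, h1, wop_single, mul_one]
      split_ifs with hs
      · have := sel_spec hs
        simp only [gam1, betaZ, hi, if_false] at this
        rw [mul_one]
        congr 1
        ext s
        · simp only [Finsupp.add_apply, Finsupp.tsub_apply, e1_apply]
          split_ifs with h
          · subst h; omega
          · simp
        · rfl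
      · simp
    have a2 : ∀ i ∈ S, h1 k i (S.erase i) (f1 k i (S.erase i) (Finsupp.single p r)) =
        if sel (fun s => gam1 S p.1 s ≠ 0) = some i then Finsupp.single p r else 0 := by
      intro i hi
      have : ∀ c, gam1 (S.erase i) (c + e1 i) = gam1 S c := by
        intro c
        rw [← gam1_insert (Finset.notMem_erase i S), Finset.insert_erase hi]
      simp only [f1, h1, wop_single, mul_one, this]
      split_ifs with hs
      · rw [mul_one]
        congr 1
        ext s <;> simp
      · simp
    rw [Finset.sum_congr rfl a1, Finset.sum_congr rfl a2, add_comm, Finset.sum_add_sum_compl,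
      sel_sum, wop_single]
    split_ifs <;> simp

lemma exact1 (x : Finset (Fin N) → (PI N →₀ k)) (hx : kD (f1 k) x = 0)
    (h0 : ∀ b, x ∅ (0, b) = 0) : kD (f1 k) (kH (h1 k) x) = x := by
  ext1 S
  have := kD_kH (f1 k) (h1 k) f1_h1 x S
  rw [hx, map_zero, Pi.zero_apply, add_zero, sum1] at this
  rw [this]
  ext ⟨c, b⟩
  rw [wop_id_apply]
  split_ifs with h
  · rw [mul_one]
  · push Not at h
    have hS : S = ∅ := by
      rw [Finset.eq_empty_iff_forall_notMem]
      intro s hs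
      have := h s
      simp only [gam1, betaZ, hs, if_true] at this
      omega
    subst hS
    have hc : c = 0 := by
      ext s
      have := h s
      simpa [gam1, betaZ] using this
    subst hc
    rw [h0, zero_mul]

/-! Model for the Hom complex -/

/-- Degree. -/
def gam2 (T : Finset (Fin N)) (c : Fin N →₀ ℕ) : Fin N → ℤ := fun s => (c s : ℤ) - betaZ N T s

lemma gam2_insert {T : Finset (Fin N)} {i : Fin N} (h : i ∉ T) (c : Fin N →₀ ℕ) :
    gam2 (insert i T) (c + e1 i) = gam2 T c := by
  ext s
  simp only [gam2, betaZ_insert h, Finsupp.add_apply]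
  push_cast
  ring

lemma gam2_sub {T : Finset (Fin N)} {i : Fin N} (h : i ∉ T) (c : Fin N →₀ ℕ)
    (hc : 0 ≤ gam2 (insert i T) c i) : gam2 T (c - e1 i) = gam2 (insert i T) c ∧
      c - e1 i + e1 i = c := by
  have h1 : 1 ≤ c i := by
    simp [gam2, betaZ] at hc
    omega
  have h2 : c - e1 i + e1 i = c := by
    ext s
    simp only [Finsupp.add_apply, Finsupp.tsub_apply, e1_apply]
    split_ifs with h
    · subst h; omega
    · simp
  refine ⟨?_, h2⟩
  rw [← gam2_insert h, h2]

variable (w : Fin N → (Fin N → ℤ) → k)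

/-- Bad index. -/
def bad (γ : Fin N → ℤ) (i : Fin N) : Prop := 0 ≤ γ i ∧ w i γ ≠ 0

/-- Raising operators. -/
def h2 (i : Fin N) (T : Finset (Fin N)) : ((Fin N →₀ ℕ) →₀ k) →ₗ[k] ((Fin N →₀ ℕ) →₀ k) :=
  wop (fun p => p + e1 i) (fun p => w i (gam2 T p))

/-- Lowering operators. -/
def f2 (i : Fin N) (T : Finset (Fin N)) : ((Fin N →₀ ℕ) →₀ k) →ₗ[k] ((Fin N →₀ ℕ) →₀ k) :=
  wop (fun p => p - e1 i) (fun p => if sel (bad w (gam2 (insert i T) p)) = some i then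
    (w i (gam2 (insert i T) p))⁻¹ else 0)

lemma f2_h2 (T : Finset (Fin N)) (i j : Fin N) (hij : i ≠ j) (hi : i ∉ T) (hj : j ∉ T)
    (m : (Fin N →₀ ℕ) →₀ k) :
    f2 w i (insert j T) (h2 w j (insert i T) m) = h2 w j T (f2 w i T m) := by
  induction m using Finsupp.induction_linear with
  | zero => simp
  | add f g hf hg => simp [hf, hg]
  | single p r =>
    have hj' : j ∉ insert i T := by simp [Ne.symm hij, hj]
    simp only [f2, h2, wop_single, Finset.insert_comm i j T, gam2_insert hj']
    split_ifs with hs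
    · have hb := sel_spec hs
      obtain ⟨g1, g2⟩ := gam2_sub hi p hb.1
      rw [g1]
      congr 1
      · ext s
        simp only [Finsupp.add_apply, Finsupp.tsub_apply, e1_apply]
        split_ifs <;> omega
      · ring
    · simp

lemma sum2 (S : Finset (Fin N)) (m : (Fin N →₀ ℕ) →₀ k) :
    ∑ i ∈ Sᶜ, f2 w i S (h2 w i S m) + ∑ i ∈ S, h2 w i (S.erase i) (f2 w i (S.erase i) m) =
      wop id (fun p => if ∃ s, bad w (gam2 S p) s then 1 else 0) m := by
  induction m using Finsupp.induction_linear with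
  | zero => simp
  | add f g hf hg =>
    simp only [map_add, Finset.sum_add_distrib]
    rw [← hf, ← hg]; abel
  | single p r =>
    have a1 : ∀ i ∈ Sᶜ, f2 w i S (h2 w i S (Finsupp.single p r)) =
        if sel (bad w (gam2 S p)) = some i then Finsupp.single p r else 0 := by
      intro i hi
      rw [Finset.mem_compl] at hi
      simp only [f2, h2, wop_single, gam2_insert hi]
      split_ifs with hs
      · have := sel_spec hs
        rw [mul_assoc, mul_inv_cancel₀ this.2, mul_one]
        congr 1
        ext s; simp
      · simp
    have a2 : ∀ i ∈ S, h2 w i (S.erase i) (f2 w i (S.erase i) (Finsupp.single p r)) =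
        if sel (bad w (gam2 S p)) = some i then Finsupp.single p r else 0 := by
      intro i hi
      simp only [f2, h2, wop_single, Finset.insert_erase hi]
      split_ifs with hs
      · have hb := sel_spec hs
        obtain ⟨g1, g2⟩ := gam2_sub (Finset.notMem_erase i S) p
          (by rw [Finset.insert_erase hi]; exact hb.1)
        rw [g1, g2, Finset.insert_erase hi, mul_assoc, inv_mul_cancel₀ hb.2, mul_one]
      · simp
    rw [Finset.sum_congr rfl a1, Finset.sum_congr rfl a2, add_comm, Finset.sum_add_sum_compl,
      sel_sum, wop_single]
    split_ifs <;> simp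

lemma exact2 (x : Finset (Fin N) → ((Fin N →₀ ℕ) →₀ k)) (hx : kH (h2 w) x = 0)
    (h0 : ∀ S a, (∀ s, ¬ bad w (gam2 S a) s) → x S a = 0) :
    kH (h2 w) (kD (f2 w) x) = x := by
  ext1 S
  have := kD_kH (f2 w) (h2 w) (f2_h2 w) x S
  rw [hx, map_zero, Pi.zero_apply, zero_add, sum2] at this
  rw [this]
  ext a
  rw [wop_id_apply]
  split_ifs with h
  · rw [mul_one]
  · push Not at h
    rw [h0 S a h, zero_mul]

lemma cob2 (x : Finset (Fin N) → ((Fin N →₀ ℕ) →₀ k)) (S : Finset (Fin N)) (a : Fin N →₀ ℕ)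
    (h : ∀ s, ¬ bad w (gam2 S a) s) : kH (h2 w) x S a = 0 := by
  rw [kH_apply, Finsupp.finsetSum_apply]
  refine Finset.sum_eq_zero fun i hi => ?_
  rw [Finsupp.smul_apply, h2, wop_apply_eq_zero, smul_zero]
  rintro b rfl
  have h3 := h i
  have h4 : gam2 S (b + e1 i) = gam2 (S.erase i) b := by
    rw [← gam2_insert (Finset.notMem_erase i S), Finset.insert_erase hi]
  rw [h4] at h3
  by_contra hne
  refine h3 ⟨?_, hne⟩
  simp [gam2, betaZ]

lemma coc2 (x : Finset (Fin N) → ((Fin N →₀ ℕ) →₀ k))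
    (h : ∀ S a, x S a ≠ 0 → ∀ s, ¬ bad w (gam2 S a) s) : kH (h2 w) x = 0 := by
  ext1 S
  rw [kH_apply]
  refine Finset.sum_eq_zero fun i hi => ?_
  rw [h2, wop_eq_zero, smul_zero]
  intro b hb
  have h3 := h _ b hb i
  by_contra hne
  refine h3 ⟨?_, hne⟩
  simp [gam2, betaZ]

end Models

section PBW
variable {k : Type} [Field k] {N : ℕ} {q : Fin N → Fin N → k}

variable (q) in
/-- Half of the commutation matrix. -/
def rr (i j : Fin N) : k := if j < i then q i j else 1

/-- Natural exponents as integers. -/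
def zv (a : Fin N →₀ ℕ) : Fin N → ℤ := fun i => (a i : ℤ)

lemma zv_add (a b : Fin N →₀ ℕ) : zv (a + b) = zv a + zv b := by
  ext i; simp [zv]

lemma zv_zero : zv (0 : Fin N →₀ ℕ) = 0 := by
  ext i; simp [zv]

variable (q) in
/-- The bicharacter. -/
def chi (a b : Fin N → ℤ) : k := ∏ i, ∏ j, rr q i j ^ (a i * b j)

lemma rr_ne_zero (hq0 : ∀ i j, q i j ≠ 0) (i j : Fin N) : rr q i j ≠ 0 := by
  unfold rr; split_ifs
  · exact hq0 _ _
  · exact one_ne_zero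

lemma chi_ne_zero (hq0 : ∀ i j, q i j ≠ 0) (a b : Fin N → ℤ) : chi q a b ≠ 0 := by
  unfold chi
  exact Finset.prod_ne_zero_iff.2 fun i _ => Finset.prod_ne_zero_iff.2 fun j _ =>
    zpow_ne_zero _ (rr_ne_zero hq0 i j)

lemma chi_add_left (hq0 : ∀ i j, q i j ≠ 0) (a a' b : Fin N → ℤ) :
    chi q (a + a') b = chi q a b * chi q a' b := by
  unfold chi
  simp only [← Finset.prod_mul_distrib]
  refine Finset.prod_congr rfl fun i _ => Finset.prod_congr rfl fun j _ => ?_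
  rw [Pi.add_apply, add_mul, zpow_add₀ (rr_ne_zero hq0 i j)]

lemma chi_add_right (hq0 : ∀ i j, q i j ≠ 0) (a b b' : Fin N → ℤ) :
    chi q a (b + b') = chi q a b * chi q a b' := by
  unfold chi
  simp only [← Finset.prod_mul_distrib]
  refine Finset.prod_congr rfl fun i _ => Finset.prod_congr rfl fun j _ => ?_
  rw [Pi.add_apply, mul_add, zpow_add₀ (rr_ne_zero hq0 i j)]

lemma chi_zero_left (b : Fin N → ℤ) : chi q 0 b = 1 := by simp [chi]
lemma chi_zero_right (b : Fin N → ℤ) : chi q b 0 = 1 := by simp [chi]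

lemma chi_e1_left (i : Fin N) (b : Fin N → ℤ) : chi q (zv (e1 i)) b = ∏ j, rr q i j ^ b j := by
  unfold chi
  rw [Finset.prod_eq_single i]
  · simp [zv]
  · intro j _ hj
    simp [zv, Ne.symm hj]
  · simp

lemma chi_e1_right (i : Fin N) (b : Fin N → ℤ) : chi q b (zv (e1 i)) = ∏ j, rr q j i ^ b j := by
  unfold chi
  refine Finset.prod_congr rfl fun l _ => ?_
  rw [Finset.prod_eq_single i]
  · simp [zv]
  · intro j _ hj
    simp [zv, Ne.symm hj]
  · simp

lemma rr_swap (hq0 : ∀ i j, q i j ≠ 0) (hq1 : ∀ i, q i i = 1)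
    (hqinv : ∀ i j, q j i = (q i j)⁻¹) (i j : Fin N) : rr q i j = q i j * rr q j i := by
  unfold rr
  rcases lt_trichotomy i j with h | h | h
  · rw [if_neg h.not_gt, if_pos h, hqinv i j, mul_inv_cancel₀ (hq0 i j)]
  · subst h; simp [hq1]
  · rw [if_neg h.not_gt, if_pos h, mul_one]

lemma chi_swap (hq0 : ∀ i j, q i j ≠ 0) (hq1 : ∀ i, q i i = 1)
    (hqinv : ∀ i j, q j i = (q i j)⁻¹) (i : Fin N) (b : Fin N → ℤ) :
    chi q (zv (e1 i)) b = (∏ s, q i s ^ b s) * chi q b (zv (e1 i)) := by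
  rw [chi_e1_left, chi_e1_right, ← Finset.prod_mul_distrib]
  refine Finset.prod_congr rfl fun j _ => ?_
  rw [rr_swap hq0 hq1 hqinv i j, mul_zpow]

lemma X_rel (i j : Fin N) :
    (X k N q i) * (X k N q j) = q i j • ((X k N q j) * (X k N q i)) := by
  simpa only [X, map_mul, map_smul] using
    RingQuot.mkAlgHom_rel k (QRel.rel (k := k) (N := N) (q := q) i j)

lemma X_rel_pow (i j : Fin N) (n : ℕ) :
    (X k N q i) * (X k N q j) ^ n = q i j ^ n • ((X k N q j) ^ n * (X k N q i)) := by
  induction n with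
  | zero => simp
  | succ n ih =>
    rw [pow_succ, ← mul_assoc, ih, smul_mul_assoc, mul_assoc, X_rel, mul_smul_comm, smul_smul,
      pow_succ, mul_assoc]

variable (q) in
/-- Monomials. -/
def mon (a : Fin N →₀ ℕ) : QSA k N q := ((List.finRange N).map (fun j => X k N q j ^ a j)).prod

lemma X_mul_list (a : Fin N →₀ ℕ) (i : Fin N) (l : List (Fin N)) (hl : l.Pairwise (· < ·))
    (hi : i ∈ l) : X k N q i * (l.map (fun j => X k N q j ^ a j)).prod =
      (l.map (fun j => rr q i j ^ a j)).prod •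
        (l.map (fun j => X k N q j ^ (a + e1 i) j)).prod := by
  induction l with
  | nil => simp at hi
  | cons j l ih =>
    rw [List.pairwise_cons] at hl
    simp only [List.map_cons, List.prod_cons]
    by_cases hij : i = j
    · subst hij
      have h1 : l.map (fun j => X k N q j ^ (a + e1 i) j) = l.map (fun j => X k N q j ^ a j) := by
        refine List.map_congr_left fun b hb => ?_
        rw [Finsupp.add_apply, e1_apply, if_neg (ne_of_gt (hl.1 b hb)), add_zero]
      have h2 : (l.map (fun j => rr q i j ^ a j)).prod = 1 := by
        refine List.prod_eq_one ?_
        intro x hx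
        rw [List.mem_map] at hx
        obtain ⟨b, hb, rfl⟩ := hx
        rw [rr, if_neg (hl.1 b hb).not_gt, one_pow]
      rw [h1, h2, Finsupp.add_apply, e1_apply, if_pos rfl, rr, if_neg (lt_irrefl i), one_pow,
        mul_one, one_smul, pow_succ', mul_assoc]
    · have hil : i ∈ l := by
        rcases List.mem_cons.1 hi with h | h
        · exact absurd h hij
        · exact h
      have hji := hl.1 i hil
      rw [← mul_assoc, X_rel_pow, smul_mul_assoc, mul_assoc, ih hl.2 hil, Finsupp.add_apply,
        e1_apply, if_neg (Ne.symm hij), add_zero, mul_smul_comm, smul_smul, rr, if_pos hji]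

lemma X_mul_mon (a : Fin N →₀ ℕ) (i : Fin N) :
    X k N q i * mon q a = chi q (zv (e1 i)) (zv a) • mon q (a + e1 i) := by
  rw [mon, X_mul_list a i _ (by exact List.pairwise_lt_finRange N) (List.mem_finRange i), mon,
    chi_e1_left, Fin.prod_univ_def]
  simp [zv]

lemma mon_zero : mon q (0 : Fin N →₀ ℕ) = 1 := by
  simp [mon]

lemma exp_induction {P : (Fin N →₀ ℕ) → Prop} (h0 : P 0) (h1 : ∀ a i, P a → P (a + e1 i))
    (a : Fin N →₀ ℕ) : P a := by
  induction a using Finsupp.induction with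
  | zero => exact h0
  | single_add i n f _ _ ih =>
    clear * - ih h1
    induction n with
    | zero => simpa using ih
    | succ n ihn =>
      have := h1 _ i ihn
      convert this using 1
      rw [e1, Finsupp.single_add]; abel

lemma mon_e1 (i : Fin N) : mon q (e1 i) = X k N q i := by
  have := X_mul_mon (q := q) 0 i
  rw [mon_zero, zv_zero, chi_zero_right, one_smul, mul_one, zero_add] at this
  exact this.symm

lemma mon_mul_mon (hq0 : ∀ i j, q i j ≠ 0) (a b : Fin N →₀ ℕ) :
    mon q a * mon q b = chi q (zv a) (zv b) • mon q (a + b) := by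
  induction a using exp_induction with
  | h0 => rw [mon_zero, zv_zero, chi_zero_left, one_smul, one_mul, zero_add]
  | h1 a i ih =>
    have h := X_mul_mon (q := q) a i
    have hc := chi_ne_zero hq0 (zv (e1 i)) (zv a)
    rw [← inv_smul_eq_iff₀ hc] at h
    rw [← h, smul_mul_assoc, mul_assoc, ih, mul_smul_comm, X_mul_mon, smul_smul, smul_smul,
      zv_add, zv_add, chi_add_left hq0, chi_add_right hq0]
    congr 1
    · field_simp
    · congr 1; abel

variable (q) in
/-- Left regular representation on the monomial model. -/
def rho (hq0 : ∀ i j, q i j ≠ 0) (hq1 : ∀ i, q i i = 1)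
    (hqinv : ∀ i j, q j i = (q i j)⁻¹) :
    QSA k N q →ₐ[k] Module.End k ((Fin N →₀ ℕ) →₀ k) :=
  RingQuot.liftAlgHom k
    ⟨FreeAlgebra.lift k (fun i => wop (fun a => a + e1 i) (fun a => chi q (zv (e1 i)) (zv a))), by
      intro x y h
      induction h with
      | rel i j =>
        simp only [map_mul, map_smul, FreeAlgebra.lift_ι_apply]
        refine Finsupp.lhom_ext fun a r => ?_
        rw [LinearMap.smul_apply, Module.End.mul_apply, Module.End.mul_apply]
        simp only [wop_single, Finsupp.smul_single]
        congr 1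
        · abel
        · rw [zv_add, zv_add, chi_add_right hq0, chi_add_right hq0,
            chi_swap hq0 hq1 hqinv i (zv (e1 j))]
          have : (∏ s, q i s ^ zv (e1 j) s) = q i j := by
            rw [Finset.prod_eq_single j]
            · simp [zv]
            · intro l _ hl
              simp [zv, Ne.symm hl]
            · simp
          rw [this, smul_eq_mul]
          ring⟩

lemma rho_X (hq0 : ∀ i j, q i j ≠ 0) (hq1 : ∀ i, q i i = 1)
    (hqinv : ∀ i j, q j i = (q i j)⁻¹) (i : Fin N) :
    rho q hq0 hq1 hqinv (X k N q i) =
      wop (fun a => a + e1 i) (fun a => chi q (zv (e1 i)) (zv a)) := by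
  rw [rho, X, RingQuot.liftAlgHom_mkAlgHom_apply, FreeAlgebra.lift_ι_apply]

lemma rho_mon (hq0 : ∀ i j, q i j ≠ 0) (hq1 : ∀ i, q i i = 1)
    (hqinv : ∀ i j, q j i = (q i j)⁻¹) (a : Fin N →₀ ℕ) :
    rho q hq0 hq1 hqinv (mon q a) (Finsupp.single 0 1) = Finsupp.single a 1 := by
  induction a using exp_induction with
  | h0 => rw [mon_zero, map_one]; rfl
  | h1 a i ih =>
    have h := X_mul_mon (q := q) a i
    have hc := chi_ne_zero hq0 (zv (e1 i)) (zv a)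
    rw [← inv_smul_eq_iff₀ hc] at h
    rw [← h, map_smul, map_mul, LinearMap.smul_apply, Module.End.mul_apply, ih, rho_X, wop_single,
      Finsupp.smul_single, one_mul, smul_eq_mul, inv_mul_cancel₀ hc]

lemma mon_bij (hq0 : ∀ i j, q i j ≠ 0) (hq1 : ∀ i, q i i = 1)
    (hqinv : ∀ i j, q j i = (q i j)⁻¹) :
    Function.Bijective (Finsupp.linearCombination k (mon q)) := by
  constructor
  · have : ∀ m, rho q hq0 hq1 hqinv (Finsupp.linearCombination k (mon q) m) (Finsupp.single 0 1)
        = m := by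
      intro m
      induction m using Finsupp.induction_linear with
      | zero => simp
      | add f g hf hg => rw [map_add, map_add, LinearMap.add_apply, hf, hg]
      | single a r =>
        rw [Finsupp.linearCombination_single, map_smul, LinearMap.smul_apply, rho_mon]
        simp
    exact Function.LeftInverse.injective
      (g := fun z => rho q hq0 hq1 hqinv z (Finsupp.single 0 1)) this
  · have key : ∀ (z : FreeAlgebra k (Fin N)) (v : QSA k N q),
        v ∈ LinearMap.range (Finsupp.linearCombination k (mon q)) →
        RingQuot.mkAlgHom k (QRel k N q) z * v ∈
          LinearMap.range (Finsupp.linearCombination k (mon q)) := by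
      intro z
      induction z using FreeAlgebra.induction with
      | grade0 r =>
        intro v hv
        rw [AlgHom.commutes, ← Algebra.smul_def]
        exact Submodule.smul_mem _ _ hv
      | grade1 i =>
        rintro v ⟨m, rfl⟩
        induction m using Finsupp.induction_linear with
        | zero => simp
        | add f g hf hg => rw [map_add, mul_add]; exact Submodule.add_mem _ hf hg
        | single a r =>
          rw [Finsupp.linearCombination_single, mul_smul_comm]
          refine Submodule.smul_mem _ _ ?_
          have := X_mul_mon (q := q) a i
          rw [X] at this
          rw [this]
          exact Submodule.smul_mem _ _ ⟨Finsupp.single (a + e1 i) 1, by simp⟩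
      | mul a b ha hb =>
        intro v hv
        rw [map_mul, mul_assoc]
        exact ha _ (hb _ hv)
      | add a b ha hb =>
        intro v hv
        rw [map_add, add_mul]
        exact Submodule.add_mem _ (ha _ hv) (hb _ hv)
    intro z
    obtain ⟨z', rfl⟩ := RingQuot.mkAlgHom_surjective k (QRel k N q) z
    have := key z' 1 ⟨Finsupp.single 0 1, by simp [mon_zero]⟩
    rwa [mul_one] at this

variable (q) in
/-- The PBW basis. -/
def monB (hq0 : ∀ i j, q i j ≠ 0) (hq1 : ∀ i, q i i = 1)
    (hqinv : ∀ i j, q j i = (q i j)⁻¹) : Module.Basis (Fin N →₀ ℕ) k (QSA k N q) :=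
  Module.Basis.ofRepr (LinearEquiv.ofBijective _ (mon_bij hq0 hq1 hqinv)).symm

lemma monB_apply (hq0 : ∀ i j, q i j ≠ 0) (hq1 : ∀ i, q i i = 1)
    (hqinv : ∀ i j, q j i = (q i j)⁻¹) (a : Fin N →₀ ℕ) : monB q hq0 hq1 hqinv a = mon q a := by
  simp [monB]

end PBW

section Resol
variable {k : Type} [Field k] {N : ℕ} {q : Fin N → Fin N → k}

variable (q) in
/-- The Koszul element. -/
def theta (i : Fin N) (T : Finset (Fin N)) : QSAe k N q :=
  (chi q (zv (e1 i)) (betaZ N T))⁻¹ • (X k N q i ⊗ₜ[k] (1 : (QSA k N q)ᵐᵒᵖ)) -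
    (chi q (betaZ N T) (zv (e1 i)))⁻¹ • ((1 : QSA k N q) ⊗ₜ[k] MulOpposite.op (X k N q i))

variable (q) in
/-- Right multiplication by the Koszul element. -/
def fA (i : Fin N) (T : Finset (Fin N)) : QSAe k N q →ₗ[QSAe k N q] QSAe k N q :=
  LinearMap.toSpanSingleton (QSAe k N q) (QSAe k N q) (theta q i T)

lemma fA_apply (i : Fin N) (T : Finset (Fin N)) (m : QSAe k N q) : fA q i T m = m * theta q i T :=
  rfl

variable (q) in
/-- Basis of the enveloping algebra. -/
def bA (hq0 : ∀ i j, q i j ≠ 0) (hq1 : ∀ i, q i i = 1) (hqinv : ∀ i j, q j i = (q i j)⁻¹) :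
    Module.Basis (PI N) k (QSAe k N q) :=
  (monB q hq0 hq1 hqinv).tensorProduct
    ((monB q hq0 hq1 hqinv).map (MulOpposite.opLinearEquiv k))

lemma bA_apply (hq0 : ∀ i j, q i j ≠ 0) (hq1 : ∀ i, q i i = 1)
    (hqinv : ∀ i j, q j i = (q i j)⁻¹) (p : PI N) :
    bA q hq0 hq1 hqinv p = mon q p.1 ⊗ₜ[k] MulOpposite.op (mon q p.2) := by
  rw [bA, Module.Basis.tensorProduct_apply', Module.Basis.map_apply, monB_apply, monB_apply]
  rfl

variable (k N) in
/-- Polynomial ring in two sets of variables. -/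
abbrev PR : Type := MvPolynomial (Fin N ⊕ Fin N) k

variable (k N) in
/-- Its monomial basis. -/
def bR : Module.Basis (PI N) k (PR k N) :=
  (MvPolynomial.basisMonomials (Fin N ⊕ Fin N) k).reindex
    (Finsupp.sumFinsuppEquivProdFinsupp)

lemma bR_apply (p : PI N) : bR k N p =
    (∏ i, MvPolynomial.X (Sum.inl i) ^ p.1 i) * ∏ i, MvPolynomial.X (Sum.inr i) ^ p.2 i := by
  rw [bR, Module.Basis.reindex_apply, MvPolynomial.coe_basisMonomials]
  dsimp only
  rw [MvPolynomial.monomial_eq,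
    Finsupp.prod_fintype _ _ (fun i => pow_zero _), Fintype.prod_sum_type]
  simp

lemma prod_pow_add_e1 {A : Type} [CommRing A] (x : Fin N → A) (a : Fin N →₀ ℕ) (i : Fin N) :
    ∏ j, x j ^ (a + e1 i) j = x i * ∏ j, x j ^ a j := by
  simp only [Finsupp.add_apply, pow_add, Finset.prod_mul_distrib]
  rw [mul_comm]
  congr 1
  rw [Finset.prod_eq_single i]
  · simp
  · intro j _ hj
    simp [Ne.symm hj]
  · simp

lemma bR_inl (p : PI N) (i : Fin N) :
    MvPolynomial.X (Sum.inl i) * bR k N p = bR k N (p.1 + e1 i, p.2) := by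
  rw [bR_apply, bR_apply]
  dsimp only
  rw [prod_pow_add_e1 (fun j => (MvPolynomial.X (Sum.inl j) : PR k N)), mul_assoc]

lemma bR_inr (p : PI N) (i : Fin N) :
    MvPolynomial.X (Sum.inr i) * bR k N p = bR k N (p.1, p.2 + e1 i) := by
  rw [bR_apply, bR_apply]
  dsimp only
  rw [prod_pow_add_e1 (fun j => (MvPolynomial.X (Sum.inr j) : PR k N)), mul_left_comm]

lemma bR_repr_X (i : Fin N) (T : Finset (Fin N)) (p : PR k N) :
    (bR k N).repr (MvPolynomial.X (Sum.inl i) * p) = f1 k i T ((bR k N).repr p) := by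
  have : ((bR k N).repr.toLinearMap ∘ₗ LinearMap.mulLeft k (MvPolynomial.X (Sum.inl i))) =
      f1 k i T ∘ₗ (bR k N).repr.toLinearMap := by
    refine (bR k N).ext fun p => ?_
    simp only [LinearMap.comp_apply, LinearMap.mulLeft_apply, LinearEquiv.coe_coe, bR_inl,
      Module.Basis.repr_self, f1, wop_single, mul_one]
  exact LinearMap.congr_fun this p

variable (k N) in
/-- Change of variables. -/
def sig : PR k N ≃ₐ[k] PR k N :=
  AlgEquiv.ofAlgHom
    (MvPolynomial.aeval (Sum.elim (fun i => MvPolynomial.X (Sum.inl i) + MvPolynomial.X (Sum.inr i))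
      (fun i => MvPolynomial.X (Sum.inr i))))
    (MvPolynomial.aeval (Sum.elim (fun i => MvPolynomial.X (Sum.inl i) - MvPolynomial.X (Sum.inr i))
      (fun i => MvPolynomial.X (Sum.inr i))))
    (by ext1 i; rcases i with i | i <;> simp)
    (by ext1 i; rcases i with i | i <;> simp)

lemma sig_z (i : Fin N) : sig k N (MvPolynomial.X (Sum.inl i) - MvPolynomial.X (Sum.inr i)) =
    MvPolynomial.X (Sum.inl i) := by
  simp [sig]

variable (q) in
/-- Twisting scalar. -/
def tw (hq0 : ∀ i j, q i j ≠ 0) (S : Finset (Fin N)) (p : PI N) : kˣ :=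
  Units.mk0 (chi q (zv p.1) (betaZ N S) * chi q (zv p.1 + betaZ N S) (zv p.2))
    (mul_ne_zero (chi_ne_zero hq0 _ _) (chi_ne_zero hq0 _ _))

variable (q) in
/-- Untwisting. -/
def Phi0 (hq0 : ∀ i j, q i j ≠ 0) (hq1 : ∀ i, q i i = 1) (hqinv : ∀ i j, q j i = (q i j)⁻¹)
    (S : Finset (Fin N)) : QSAe k N q ≃ₗ[k] PR k N :=
  (bA q hq0 hq1 hqinv).equiv ((bR k N).unitsSMul (tw q hq0 S)) (Equiv.refl _)

section
variable (hq0 : ∀ i j, q i j ≠ 0) (hq1 : ∀ i, q i i = 1) (hqinv : ∀ i j, q j i = (q i j)⁻¹)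

lemma Phi0_mon (S : Finset (Fin N)) (a b : Fin N →₀ ℕ) :
    Phi0 q hq0 hq1 hqinv S (mon q a ⊗ₜ[k] MulOpposite.op (mon q b)) =
      (chi q (zv a) (betaZ N S) * chi q (zv a + betaZ N S) (zv b)) • bR k N (a, b) := by
  have := bA_apply hq0 hq1 hqinv (a, b)
  dsimp only at this
  rw [← this, Phi0, Module.Basis.equiv_apply, Module.Basis.unitsSMul_apply]
  rfl

lemma betaZ_insert' {T : Finset (Fin N)} {i : Fin N} (h : i ∉ T) :
    betaZ N (insert i T) = betaZ N T + zv (e1 i) := by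
  ext s; exact betaZ_insert h s

lemma mon_mul_X (a : Fin N →₀ ℕ) (i : Fin N) (hq0 : ∀ i j, q i j ≠ 0) :
    mon q a * X k N q i = chi q (zv a) (zv (e1 i)) • mon q (a + e1 i) := by
  rw [← mon_e1, mon_mul_mon hq0]

lemma e_mul_sub (m a b : QSAe k N q) : m * (a - b) = m * a - m * b := mul_sub m a b

lemma Phi0_theta (T : Finset (Fin N)) (i : Fin N) (hi : i ∉ T) (m : QSAe k N q) :
    Phi0 q hq0 hq1 hqinv T (m * theta q i T) =
      (MvPolynomial.X (Sum.inl i) - MvPolynomial.X (Sum.inr i)) *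
        Phi0 q hq0 hq1 hqinv (insert i T) m := by
  have : (Phi0 q hq0 hq1 hqinv T).toLinearMap ∘ₗ LinearMap.mulRight k (theta q i T) =
      LinearMap.mulLeft k (MvPolynomial.X (Sum.inl i) - MvPolynomial.X (Sum.inr i)) ∘ₗ
        (Phi0 q hq0 hq1 hqinv (insert i T)).toLinearMap := by
    refine (bA q hq0 hq1 hqinv).ext fun p => ?_
    obtain ⟨a, b⟩ := p
    simp only [LinearMap.comp_apply, LinearMap.mulLeft_apply, LinearMap.mulRight_apply,
      LinearEquiv.coe_coe, bA_apply, Phi0_mon]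
    rw [theta, e_mul_sub, mul_smul_comm, mul_smul_comm, Algebra.TensorProduct.tmul_mul_tmul,
      Algebra.TensorProduct.tmul_mul_tmul, mul_one, mul_one, ← MulOpposite.op_mul,
      mon_mul_X _ _ hq0, X_mul_mon, MulOpposite.op_smul, ← TensorProduct.smul_tmul',
      TensorProduct.tmul_smul, map_sub, map_smul, map_smul, map_smul, map_smul, Phi0_mon, Phi0_mon,
      mul_smul_comm, sub_mul, bR_inl, bR_inr, smul_sub, smul_smul, smul_smul, smul_smul, smul_smul]
    have c1 := chi_ne_zero hq0 (zv (e1 i)) (betaZ N T)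
    have c2 := chi_ne_zero hq0 (betaZ N T) (zv (e1 i))
    rw [betaZ_insert' hi]
    simp only [zv_add, chi_add_left hq0, chi_add_right hq0]
    congr 2
    · field_simp
    · field_simp
  exact LinearMap.congr_fun this m

variable (q) in
/-- Full linearization. -/
def Phi (S : Finset (Fin N)) : QSAe k N q ≃ₗ[k] (PI N →₀ k) :=
  (Phi0 q hq0 hq1 hqinv S).trans ((sig k N).toLinearEquiv.trans (bR k N).repr)

lemma Phi_apply (S : Finset (Fin N)) (m : QSAe k N q) : Phi q hq0 hq1 hqinv S m =
    (bR k N).repr (sig k N (Phi0 q hq0 hq1 hqinv S m)) := rfl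

lemma Phi_fA (T : Finset (Fin N)) (i : Fin N) (hi : i ∉ T) (m : QSAe k N q) :
    Phi q hq0 hq1 hqinv T (fA q i T m) = f1 k i T (Phi q hq0 hq1 hqinv (insert i T) m) := by
  rw [Phi_apply, Phi_apply, fA_apply, Phi0_theta hq0 hq1 hqinv T i hi, map_mul, sig_z, bR_repr_X]

lemma f1_comm (i j : Fin N) (T T' U U' : Finset (Fin N)) (m : PI N →₀ k) :
    f1 k i T (f1 k j T' m) = f1 k j U (f1 k i U' m) := by
  induction m using Finsupp.induction_linear with
  | zero => simp
  | add f g hf hg => simp only [map_add, hf, hg]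
  | single p r =>
    simp only [f1, wop_single]
    congr 2
    abel

include hq0 hq1 hqinv in
lemma fA_comm (T : Finset (Fin N)) (i j : Fin N) (hij : i ≠ j) (hi : i ∉ T) (hj : j ∉ T)
    (m : QSAe k N q) :
    fA q i T (fA q j (insert i T) m) = fA q j T (fA q i (insert j T) m) := by
  apply (Phi q hq0 hq1 hqinv T).injective
  rw [Phi_fA hq0 hq1 hqinv T i hi, Phi_fA hq0 hq1 hqinv T j hj,
    Phi_fA hq0 hq1 hqinv _ j (by simp [Ne.symm hij, hj]),
    Phi_fA hq0 hq1 hqinv _ i (by simp [hij, hi]), Finset.insert_comm j i T]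
  exact f1_comm _ _ _ _ _ _ _

variable (q) in
/-- Augmentation. -/
def epsA : QSAe k N q →ₗ[QSAe k N q] QSA k N q :=
  LinearMap.toSpanSingleton (QSAe k N q) (QSA k N q) 1

lemma epsA_tmul (a b : QSA k N q) : epsA q (a ⊗ₜ[k] MulOpposite.op b) = a * b := by
  have : epsA q (a ⊗ₜ[k] MulOpposite.op b) = (a ⊗ₜ[k] MulOpposite.op b : QSAe k N q) • (1 : QSA k N q) := rfl
  rw [this, TensorProduct.Algebra.smul_def]
  simp

end
end Resol

section Aug
variable {k : Type} [Field k] {N : ℕ} {q : Fin N → Fin N → k}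

variable (k N) in
/-- Setting the first variables to zero. -/
def pi0 : PR k N →ₐ[k] MvPolynomial (Fin N) k :=
  MvPolynomial.aeval (Sum.elim (fun _ => 0) (fun i => MvPolynomial.X i))

lemma prodX (a : Fin N →₀ ℕ) :
    ∏ i, (MvPolynomial.X i : MvPolynomial (Fin N) k) ^ a i = MvPolynomial.monomial a 1 := by
  rw [MvPolynomial.monomial_eq, Finsupp.prod_fintype _ _ (fun i => pow_zero _)]
  simp

lemma bR_repr_zero (p : PR k N) (b : Fin N →₀ ℕ) :
    (bR k N).repr p (0, b) = MvPolynomial.coeff b (pi0 k N p) := by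
  have : Finsupp.lapply (0, b) ∘ₗ (bR k N).repr.toLinearMap =
      MvPolynomial.lcoeff k b ∘ₗ (pi0 k N).toLinearMap := by
    refine (bR k N).ext fun p => ?_
    obtain ⟨a, c⟩ := p
    have e : pi0 k N (bR k N (a, c)) = (∏ i, (0 : MvPolynomial (Fin N) k) ^ a i) *
        MvPolynomial.monomial c 1 := by
      rw [bR_apply, ← prodX]
      simp [pi0]
    simp only [LinearMap.comp_apply, LinearEquiv.coe_coe, AlgHom.toLinearMap_apply, e,
      Module.Basis.repr_self, Finsupp.lapply_apply, MvPolynomial.lcoeff_apply]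
    by_cases ha : a = 0
    · subst ha
      simp [Finsupp.single_apply]
    · obtain ⟨i, hi⟩ := Finsupp.ne_iff.mp ha
      have h0 : (∏ i, (0 : MvPolynomial (Fin N) k) ^ a i) = 0 :=
        Finset.prod_eq_zero (Finset.mem_univ i) (zero_pow hi)
      rw [h0, zero_mul, MvPolynomial.coeff_zero, Finsupp.single_apply, if_neg]
      simp [ha]
  exact LinearMap.congr_fun this p

lemma pi0_sig (a b : Fin N →₀ ℕ) :
    pi0 k N (sig k N (bR k N (a, b))) = MvPolynomial.monomial (a + b) 1 := by
  rw [bR_apply, ← prodX]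
  simp [pi0, sig, pow_add, Finset.prod_mul_distrib]

lemma betaZ_empty : betaZ N ∅ = 0 := by
  ext s; simp [betaZ]

variable (hq0 : ∀ i j, q i j ≠ 0) (hq1 : ∀ i, q i i = 1) (hqinv : ∀ i j, q j i = (q i j)⁻¹)

lemma epsA_smul (c : k) (m : QSAe k N q) : epsA q (c • m) = c • epsA q m := by
  induction m using TensorProduct.induction_on with
  | zero => rw [smul_zero, map_zero, smul_zero]
  | add x y hx hy => rw [smul_add, map_add, map_add, smul_add, hx, hy]
  | tmul x y =>
    induction y using MulOpposite.rec' with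
    | h y => rw [TensorProduct.smul_tmul', epsA_tmul, epsA_tmul, smul_mul_assoc]

variable (q) in
/-- Augmentation as a linear map over the field. -/
def epsK : QSAe k N q →ₗ[k] QSA k N q where
  toFun := epsA q
  map_add' := map_add _
  map_smul' := epsA_smul

lemma Phi_eps (m : QSAe k N q) (c : Fin N →₀ ℕ) :
    Phi q hq0 hq1 hqinv ∅ m (0, c) = (monB q hq0 hq1 hqinv).repr (epsA q m) c := by
  have : Finsupp.lapply (0, c) ∘ₗ (Phi q hq0 hq1 hqinv ∅).toLinearMap =
      Finsupp.lapply c ∘ₗ (monB q hq0 hq1 hqinv).repr.toLinearMap ∘ₗ epsK q := by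
    refine (bA q hq0 hq1 hqinv).ext fun p => ?_
    obtain ⟨a, b⟩ := p
    have e2 : epsK q (mon q a ⊗ₜ[k] MulOpposite.op (mon q b)) =
        chi q (zv a) (zv b) • monB q hq0 hq1 hqinv (a + b) := by
      rw [monB_apply, ← mon_mul_mon hq0]
      exact epsA_tmul _ _
    simp only [LinearMap.comp_apply, LinearEquiv.coe_coe, bA_apply, e2, Finsupp.lapply_apply,
      Phi_apply, bR_repr_zero, Phi0_mon, map_smul, pi0_sig, Module.Basis.repr_self, betaZ_empty,
      chi_zero_right, add_zero, one_mul]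
    simp [MvPolynomial.coeff_monomial, Finsupp.single_apply]
  exact LinearMap.congr_fun this m

lemma eps_fA (i : Fin N) (m : QSAe k N q) : epsA q (fA q i ∅ m) = 0 := by
  have e1' : epsA q (X k N q i ⊗ₜ[k] 1) = X k N q i := by
    have := epsA_tmul (q := q) (X k N q i) 1
    rwa [mul_one, MulOpposite.op_one] at this
  rw [fA_apply, ← smul_eq_mul, map_smul, theta, map_sub, epsA_smul, epsA_smul, e1',
    epsA_tmul, betaZ_empty, chi_zero_left, chi_zero_right, one_mul, sub_self, smul_zero]

include hq0 hq1 hqinv in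
lemma exactA (x : Finset (Fin N) → QSAe k N q) (hx : kD (R := QSAe k N q) (fA q) x = 0) (h0 : epsA q (x ∅) = 0) :
    ∃ y, kD (R := QSAe k N q) (fA q) y = x := by
  have tr : ∀ y : Finset (Fin N) → QSAe k N q,
      kD (f1 k) (fun S => Phi q hq0 hq1 hqinv S (y S)) =
        fun S => Phi q hq0 hq1 hqinv S (kD (R := QSAe k N q) (fA q) y S) := by
    intro y
    funext S
    rw [kD_apply, kD_apply, map_sum]
    refine Finset.sum_congr rfl fun i hi => ?_
    rw [map_zsmul, Phi_fA _ _ _ _ _ (by simpa using hi)]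
  let z := kH (h1 k) (fun S => Phi q hq0 hq1 hqinv S (x S))
  have hz : kD (f1 k) z = fun S => Phi q hq0 hq1 hqinv S (x S) := by
    apply exact1
    · rw [tr, hx]
      funext S
      simp
    · intro b
      rw [Phi_eps, h0, map_zero, Finsupp.zero_apply]
  refine ⟨fun S => (Phi q hq0 hq1 hqinv S).symm (z S), ?_⟩
  have := tr (fun S => (Phi q hq0 hq1 hqinv S).symm (z S))
  simp only [LinearEquiv.apply_symm_apply] at this
  change kD (f1 k) z = _ at this
  rw [hz] at this
  funext S
  exact ((Phi q hq0 hq1 hqinv S).injective (congrFun this S)).symm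

/-- Terms of the resolution. -/
abbrev KK (q : Fin N → Fin N → k) (n : ℕ) : Type := SubN N n → QSAe k N q

variable (q) in
/-- Differential of the resolution. -/
def dA (n : ℕ) : KK q (n + 1) →ₗ[QSAe k N q] KK q n :=
  dK (N := N) (R := QSAe k N q) (M := QSAe k N q) (fA q) n

lemma dA_apply (n : ℕ) (x : KK q (n + 1)) :
    dA q n x = dK (N := N) (R := QSAe k N q) (M := QSAe k N q) (fA q) n x := rfl

include hq0 hq1 hqinv in
lemma res_dd (n : ℕ) : dA q n ∘ₗ dA q (n + 1) = 0 := by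
  refine LinearMap.ext fun x => ?_
  have h := kD_kD (R := QSAe k N q) (fA q) (fun T i j hij hi hj m => fA_comm hq0 hq1 hqinv T i j hij hi hj m)
    (kExt N (QSAe k N q) _ (n + 2) x)
  rw [← kExt_dK, ← kExt_dK] at h
  have h2 := congrArg (kRes N (QSAe k N q) _ n) h
  rw [kRes_kExt, map_zero] at h2
  exact h2

variable (q) in
/-- Augmentation of the resolution. -/
def epsR : KK q 0 →ₗ[QSAe k N q] QSA k N q :=
  epsA q ∘ₗ LinearMap.proj (⟨∅, rfl⟩ : SubN N 0)

lemma epsR_surj : Function.Surjective (epsR q) := by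
  intro a
  refine ⟨fun _ => a ⊗ₜ[k] MulOpposite.op 1, ?_⟩
  change epsA q (a ⊗ₜ[k] MulOpposite.op 1) = a
  rw [epsA_tmul, mul_one]

lemma epsR_d : epsR q ∘ₗ dA q 0 = 0 := by
  refine LinearMap.ext fun x => ?_
  change epsA q (kD (R := QSAe k N q) (fA q) _ ∅) = 0
  rw [kD_apply, map_sum]
  refine Finset.sum_eq_zero fun i _ => ?_
  rw [map_zsmul, eps_fA]
  exact smul_zero _

include hq0 hq1 hqinv in
lemma ex0 (x : KK q 0) (hx : epsR q x = 0) : ∃ y, dA q 0 y = x := by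
  obtain ⟨y, hy⟩ := exactA hq0 hq1 hqinv (kExt N (QSAe k N q) _ 0 x) (by
    funext S
    rw [kD_apply]
    refine Finset.sum_eq_zero fun i _ => ?_
    rw [kExt_apply_ne, map_zero]
    · exact smul_zero _
    exact (Finset.card_pos.mpr ⟨i, Finset.mem_insert_self _ _⟩).ne')
    (by rw [kExt_apply 0 x (Finset.card_empty)]; exact hx)
  refine ⟨kRes N (QSAe k N q) (QSAe k N q) 1 y, ?_⟩
  rw [dA_apply, ← kRes_kD, hy, kRes_kExt]

include hq0 hq1 hqinv in
lemma exn (n : ℕ) (x : KK q (n + 1)) (hx : dA q n x = 0) : ∃ y, dA q (n + 1) y = x := by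
  obtain ⟨y, hy⟩ := exactA hq0 hq1 hqinv (kExt N (QSAe k N q) _ (n + 1) x)
    (by rw [← kExt_dK, ← dA_apply, hx, map_zero])
    (by rw [kExt_apply_ne, map_zero]; simp)
  refine ⟨kRes N (QSAe k N q) (QSAe k N q) (n + 2) y, ?_⟩
  rw [dA_apply, ← kRes_kD, hy, kRes_kExt]

end Aug

section HomSide
variable {k : Type} [Field k] {N : ℕ} {q : Fin N → Fin N → k}

variable (q) in
/-- The scalar weights of the Hom complex. -/
def wt (lam : Fin N → k) (i : Fin N) (γ : Fin N → ℤ) : k :=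
  chi q (zv (e1 i)) γ - lam i * chi q γ (zv (e1 i))

variable (hq0 : ∀ i j, q i j ≠ 0) (hq1 : ∀ i, q i i = 1) (hqinv : ∀ i j, q j i = (q i j)⁻¹)
  (lam : Fin N → k)

include hq0 hq1 hqinv in
lemma good_iff (S : Finset (Fin N)) (a : Fin N →₀ ℕ) :
    (∀ s, ¬ bad (wt q lam) (gam2 S a) s) ↔
      ((fun s => ((a s : ℤ))) - betaZ N S) ∈ Cg k N q lam := by
  change _ ↔ gam2 S a ∈ Cg k N q lam
  refine forall_congr' fun i => ?_
  have hw : wt q lam i (gam2 S a) =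
      ((∏ s, q i s ^ (gam2 S a) s) - lam i) * chi q (gam2 S a) (zv (e1 i)) := by
    rw [wt, chi_swap hq0 hq1 hqinv, sub_mul]
  have hge : -1 ≤ gam2 S a i := by
    simp only [gam2, betaZ]
    split_ifs <;> omega
  rw [bad, hw, not_and_or, not_le, not_not, mul_eq_zero, or_iff_left (chi_ne_zero hq0 _ _),
    sub_eq_zero, or_comm]
  have : gam2 S a i < 0 ↔ gam2 S a i = -1 := by omega
  rw [this]

variable (q) in
/-- Coordinates on the twisted bimodule. -/
def ag : Ag k N q lam ≃+ ((Fin N →₀ ℕ) →₀ k) :=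
  ((monB q hq0 hq1 hqinv).repr.toAddEquiv : QSA k N q ≃+ ((Fin N →₀ ℕ) →₀ k))

lemma gAlg_X (i : Fin N) : gAlg k N q lam (X k N q i) = lam i • X k N q i := by
  rw [gAlg, X, RingQuot.liftAlgHom_mkAlgHom_apply, FreeAlgebra.lift_ι_apply]
  rfl

/-- The identification of the underlying type. -/
def toA : Ag k N q lam → QSA k N q := id

lemma toA_smul (e : QSAe k N q) (y : Ag k N q lam) :
    toA lam (e • y) = taug k N q lam e • toA lam y := rfl

lemma smul_tmul_A (a b y : QSA k N q) :
    (a ⊗ₜ[k] MulOpposite.op b : QSAe k N q) • y = a * y * b := by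
  rw [TensorProduct.Algebra.smul_def]
  simp [mul_assoc]

lemma e_zero_smul (y : QSA k N q) : (0 : QSAe k N q) • y = 0 := zero_smul (QSAe k N q) y

lemma e_sub_smul (a b : QSAe k N q) (y : QSA k N q) : (a - b) • y = a • y - b • y := sub_smul a b y

lemma ksmul_A (c : k) (e : QSAe k N q) (y : QSA k N q) : (c • e) • y = c • (e • y) := by
  induction e using TensorProduct.induction_on with
  | zero => rw [smul_zero, e_zero_smul, smul_zero]
  | add x z hx hz => rw [smul_add, add_smul, add_smul, smul_add, hx, hz]
  | tmul x z =>
    induction z using MulOpposite.rec' with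
    | h z => rw [TensorProduct.smul_tmul', smul_tmul_A, smul_tmul_A, smul_mul_assoc, smul_mul_assoc]

lemma ag_smul (c : k) (y : Ag k N q lam) :
    ag q hq0 hq1 hqinv lam (algebraMap k (QSAe k N q) c • y) = c • ag q hq0 hq1 hqinv lam y := by
  change (monB q hq0 hq1 hqinv).repr (toA lam (algebraMap k (QSAe k N q) c • y)) =
    c • (monB q hq0 hq1 hqinv).repr (toA lam y)
  rw [toA_smul, AlgHom.commutes, Algebra.algebraMap_eq_smul_one, ksmul_A, one_smul, map_smul]

lemma taug_theta (i : Fin N) (T : Finset (Fin N)) (y : QSA k N q) :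
    taug k N q lam (theta q i T) • y =
      (chi q (zv (e1 i)) (betaZ N T))⁻¹ • (X k N q i * y) -
      ((chi q (betaZ N T) (zv (e1 i)))⁻¹ * lam i) • (y * X k N q i) := by
  have h1 : taug k N q lam (X k N q i ⊗ₜ[k] (1 : (QSA k N q)ᵐᵒᵖ)) =
      X k N q i ⊗ₜ[k] MulOpposite.op 1 := by
    rw [taug, Algebra.TensorProduct.map_tmul, map_one]; rfl
  have h2 : taug k N q lam ((1 : QSA k N q) ⊗ₜ[k] MulOpposite.op (X k N q i)) =
      1 ⊗ₜ[k] MulOpposite.op (lam i • X k N q i) := by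
    rw [taug, Algebra.TensorProduct.map_tmul, map_one, ← gAlg_X]; rfl
  rw [theta, map_sub, map_smul, map_smul, h1, h2, e_sub_smul, ksmul_A, ksmul_A, smul_tmul_A,
    smul_tmul_A, mul_one, one_mul, mul_smul_comm, smul_smul]

lemma ag_theta (i : Fin N) (T : Finset (Fin N)) (y : Ag k N q lam) :
    ag q hq0 hq1 hqinv lam (theta q i T • y) =
      h2 (wt q lam) i T (ag q hq0 hq1 hqinv lam y) := by
  change (monB q hq0 hq1 hqinv).repr (toA lam (theta q i T • y)) =
    h2 (wt q lam) i T ((monB q hq0 hq1 hqinv).repr (toA lam y))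
  rw [toA_smul, taug_theta]
  generalize toA lam y = y
  have : (monB q hq0 hq1 hqinv).repr.toLinearMap ∘ₗ
      ((chi q (zv (e1 i)) (betaZ N T))⁻¹ • LinearMap.mulLeft k (X k N q i) -
      ((chi q (betaZ N T) (zv (e1 i)))⁻¹ * lam i) • LinearMap.mulRight k (X k N q i)) =
      h2 (wt q lam) i T ∘ₗ (monB q hq0 hq1 hqinv).repr.toLinearMap := by
    refine (monB q hq0 hq1 hqinv).ext fun a => ?_
    have e1' : X k N q i * monB q hq0 hq1 hqinv a =
        chi q (zv (e1 i)) (zv a) • monB q hq0 hq1 hqinv (a + e1 i) := by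
      rw [monB_apply, monB_apply, X_mul_mon]
    have e2' : monB q hq0 hq1 hqinv a * X k N q i =
        chi q (zv a) (zv (e1 i)) • monB q hq0 hq1 hqinv (a + e1 i) := by
      rw [monB_apply, monB_apply, mon_mul_X _ _ hq0]
    simp only [LinearMap.comp_apply, LinearMap.sub_apply, LinearMap.smul_apply,
      LinearMap.mulLeft_apply, LinearMap.mulRight_apply, LinearEquiv.coe_coe, e1', e2', map_smul, Module.Basis.repr_self, h2, wop_single, smul_smul, ← sub_smul]
    rw [Finsupp.smul_single, smul_eq_mul]
    congr 1
    have hg : zv a = gam2 T a + betaZ N T := by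
      funext s; simp [zv, gam2]
    rw [hg, chi_add_left hq0, chi_add_right hq0, wt]
    have c1 := chi_ne_zero hq0 (zv (e1 i)) (betaZ N T)
    have c2 := chi_ne_zero hq0 (betaZ N T) (zv (e1 i))
    field_simp
  exact LinearMap.congr_fun this y

end HomSide

section AbsHom
variable {N : ℕ} {E : Type} [Ring E] {Y : Type} [AddCommGroup Y] [Module E Y]

lemma hom_total (n : ℕ) (φ : (SubN N n → E) →ₗ[E] Y) (x : SubN N n → E) :
    φ x = ∑ T : Finset (Fin N), kExt N E E n x T •
      kExt N E Y n (fun T => φ (Pi.single T 1)) T := by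
  have h1 : φ x = ∑ T : SubN N n, x T • φ (Pi.single T 1) := by
    conv_lhs => rw [← Finset.univ_sum_single x]
    rw [map_sum]
    refine Finset.sum_congr rfl fun T _ => ?_
    rw [← map_smul, ← Pi.single_smul, smul_eq_mul, mul_one]
  rw [h1, ← Finset.sum_filter_add_sum_filter_not Finset.univ (fun T : Finset (Fin N) => T.card = n)]
  rw [Finset.sum_eq_zero (s := Finset.univ.filter (fun T : Finset (Fin N) => ¬ T.card = n)), add_zero]
  · symm
    rw [Finset.sum_subtype (p := fun T : Finset (Fin N) => T.card = n) _ (by simp)]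
    refine Finset.sum_congr rfl fun T _ => ?_
    rw [kExt_apply n x T.2, kExt_apply n _ T.2]
  · intro T hT
    rw [kExt_apply_ne n x (by simpa using hT), zero_smul]

lemma hom_d (θ : Fin N → Finset (Fin N) → E) (n : ℕ) (φ : (SubN N n → E) →ₗ[E] Y)
    (S : SubN N (n + 1)) :
    φ (dK (fun i T => LinearMap.toSpanSingleton E E (θ i T)) n (Pi.single S 1)) =
      ∑ i ∈ S.1, sg i S.1 • θ i (S.1.erase i) •
        kExt N E Y n (fun T => φ (Pi.single T 1)) (S.1.erase i) := by
  rw [hom_total, kExt_dK]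
  generalize kExt N E Y n (fun T => φ (Pi.single T 1)) = y
  have hs : ∀ T, kExt N E E (n + 1) (Pi.single S 1) T = if T = S.1 then 1 else 0 := by
    intro T
    by_cases h : T.card = n + 1
    · rw [kExt_apply _ _ h, Pi.single_apply]
      simp only [Subtype.ext_iff]
    · rw [kExt_apply_ne _ _ h, if_neg]
      rintro rfl
      exact h S.2
  have h1 : ∀ T : Finset (Fin N),
      kD (fun i T => LinearMap.toSpanSingleton E E (θ i T)) (kExt N E E (n + 1) (Pi.single S 1)) T • y T
        = ∑ i, if i ∈ S.1 ∧ T = S.1.erase i then sg i S.1 • θ i (S.1.erase i) • y (S.1.erase i)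
            else 0 := by
    intro T
    rw [kD_apply, Finset.sum_smul, ← Finset.sum_filter_add_sum_filter_not Finset.univ (fun i => i ∈ Tᶜ)]
    rw [Finset.sum_eq_zero (s := Finset.univ.filter (fun i => ¬ i ∈ Tᶜ)), add_zero]
    · rw [Finset.filter_univ_mem]
      refine Finset.sum_congr rfl fun i hi => ?_
      have hi' : i ∉ T := by simpa using hi
      rw [hs, LinearMap.toSpanSingleton_apply]
      by_cases h : insert i T = S.1
      · have hT : T = S.1.erase i := by rw [← h, Finset.erase_insert hi']
        have hiS : i ∈ S.1 := by rw [← h]; exact Finset.mem_insert_self _ _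
        rw [if_pos h, if_pos ⟨hiS, hT⟩, one_smul, ← hT, smul_assoc, ← h, sg_insert_self hi']
      · rw [if_neg h, if_neg, zero_smul, smul_zero, zero_smul]
        rintro ⟨hiS, rfl⟩
        exact h (Finset.insert_erase hiS)
    · intro i hi
      rw [if_neg]
      rintro ⟨hiS, rfl⟩
      simp at hi
  rw [Finset.sum_congr rfl fun T _ => h1 T, Finset.sum_comm]
  rw [← Finset.sum_filter_add_sum_filter_not Finset.univ (fun i => i ∈ S.1), Finset.filter_univ_mem,
    Finset.sum_eq_zero (s := Finset.univ.filter (fun i => ¬ i ∈ S.1)), add_zero]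
  · refine Finset.sum_congr rfl fun i hi => ?_
    simp [hi]
  · intro i hi
    have : i ∉ S.1 := by simpa using hi
    simp [this]

lemma hom_ext (n : ℕ) (φ ψ : (SubN N n → E) →ₗ[E] Y)
    (h : ∀ S, φ (Pi.single S 1) = ψ (Pi.single S 1)) : φ = ψ := by
  refine (Pi.basisFun E (SubN N n)).ext fun S => ?_
  rw [Pi.basisFun_apply]
  exact h S

lemma hom_exists (n : ℕ) (y : SubN N n → Y) :
    ∃ φ : (SubN N n → E) →ₗ[E] Y, ∀ S, φ (Pi.single S 1) = y S := by
  refine ⟨∑ S, LinearMap.toSpanSingleton E Y (y S) ∘ₗ LinearMap.proj S, fun S => ?_⟩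
  rw [LinearMap.sum_apply, Finset.sum_eq_single S]
  · simp
  · intro T _ hT
    simp [Pi.single_eq_of_ne hT]
  · simp

end AbsHom

section Coef
variable {k : Type} [Field k] {N : ℕ}

/-- Extraction of the good coefficients. -/
def Pz {m : ℕ} (Q : (Fin N → ℕ) × Finset (Fin N) → Prop) (z : SubN N m → ((Fin N →₀ ℕ) →₀ k)) :
    {p : (Fin N → ℕ) × Finset (Fin N) // p.2.card = m ∧ Q p} →₀ k :=
  Finsupp.ofSupportFinite (fun p => z ⟨p.1.2, p.2.1⟩ (Finsupp.equivFunOnFinite.symm p.1.1)) (by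
    refine Set.Finite.subset (Set.Finite.preimage (f := fun p : {p : (Fin N → ℕ) × Finset (Fin N) //
      p.2.card = m ∧ Q p} => ((⟨p.1.2, p.2.1⟩ : SubN N m), Finsupp.equivFunOnFinite.symm p.1.1))
      (s := ⋃ S : SubN N m, {S} ×ˢ ((z S).support : Set (Fin N →₀ ℕ))) ?_
      (Set.finite_iUnion fun S => (Set.finite_singleton S).prod (Finset.finite_toSet _))) ?_
    · rintro ⟨⟨a, S⟩, h⟩ _ ⟨⟨a', S'⟩, h'⟩ _ he
      simp only [Prod.mk.injEq, Subtype.mk.injEq, EmbeddingLike.apply_eq_iff_eq] at he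
      obtain ⟨rfl, rfl⟩ := he
      rfl
    · rintro p hp
      simp only [Set.mem_preimage, Set.mem_iUnion, Set.mem_prod, Set.mem_singleton_iff]
      exact ⟨_, rfl, by simpa using hp⟩)

lemma Pz_apply {m : ℕ} (Q : (Fin N → ℕ) × Finset (Fin N) → Prop)
    (z : SubN N m → ((Fin N →₀ ℕ) →₀ k)) (p) :
    Pz Q z p = z ⟨p.1.2, p.2.1⟩ (Finsupp.equivFunOnFinite.symm p.1.1) := rfl

lemma Pz_surj {m : ℕ} (Q : (Fin N → ℕ) × Finset (Fin N) → Prop)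
    (g : {p : (Fin N → ℕ) × Finset (Fin N) // p.2.card = m ∧ Q p} →₀ k) :
    ∃ z : SubN N m → ((Fin N →₀ ℕ) →₀ k), Pz Q z = g ∧ ∀ S a, z S a ≠ 0 → Q (a, S.1) := by
  have hinj : ∀ S : SubN N m, Function.Injective
      (fun a : Fin N →₀ ℕ => ((a : Fin N → ℕ), S.1)) := by
    intro S a b h
    exact Finsupp.ext fun i => congrFun (Prod.ext_iff.mp h).1 i
  have hz : ∃ z : SubN N m → ((Fin N →₀ ℕ) →₀ k), ∀ S a, z S a =
      g.extendDomain ((a : Fin N → ℕ), S.1) :=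
    ⟨fun S => (g.extendDomain).comapDomain (fun a : Fin N →₀ ℕ => ((a : Fin N → ℕ), S.1))
      (hinj S).injOn, fun S a => rfl⟩
  obtain ⟨z, hz⟩ := hz
  refine ⟨z, ?_, ?_⟩
  · ext p
    rw [Pz_apply, hz, Finsupp.extendDomain_apply]
    exact dif_pos p.2
  · intro S a h
    rw [hz, Finsupp.extendDomain_apply] at h
    by_contra hQ
    exact h (dif_neg (fun h' => hQ h'.2))

end Coef

section Final
variable {k : Type} [Field k] {N : ℕ} {q : Fin N → Fin N → k}
variable (hq0 : ∀ i j, q i j ≠ 0) (hq1 : ∀ i, q i i = 1) (hqinv : ∀ i j, q j i = (q i j)⁻¹)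
  (lam : Fin N → k)

variable (q) in
/-- Coordinates of a cochain. -/
def ev (m : ℕ) (φ : KK q m →ₗ[QSAe k N q] Ag k N q lam) : SubN N m → ((Fin N →₀ ℕ) →₀ k) :=
  fun S => ag q hq0 hq1 hqinv lam (φ (Pi.single S 1))

lemma ev_add (m : ℕ) (φ ψ : KK q m →ₗ[QSAe k N q] Ag k N q lam) :
    ev q hq0 hq1 hqinv lam m (φ + ψ) = ev q hq0 hq1 hqinv lam m φ + ev q hq0 hq1 hqinv lam m ψ := by
  funext S
  exact map_add (ag q hq0 hq1 hqinv lam) _ _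

lemma ev_zero (m : ℕ) :
    ev q hq0 hq1 hqinv lam m (0 : KK q m →ₗ[QSAe k N q] Ag k N q lam) = 0 := by
  funext S
  exact map_zero (ag q hq0 hq1 hqinv lam)

lemma ev_inj (m : ℕ) (φ ψ : KK q m →ₗ[QSAe k N q] Ag k N q lam)
    (h : ev q hq0 hq1 hqinv lam m φ = ev q hq0 hq1 hqinv lam m ψ) : φ = ψ :=
  hom_ext (E := QSAe k N q) m φ ψ fun S => (ag q hq0 hq1 hqinv lam).injective (congrFun h S)

lemma ev_surj (m : ℕ) (z : SubN N m → ((Fin N →₀ ℕ) →₀ k)) :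
    ∃ φ : KK q m →ₗ[QSAe k N q] Ag k N q lam, ev q hq0 hq1 hqinv lam m φ = z := by
  obtain ⟨φ, hφ⟩ := hom_exists (E := QSAe k N q) m
    (fun S => (ag q hq0 hq1 hqinv lam).symm (z S))
  refine ⟨φ, ?_⟩
  funext S
  rw [ev, hφ, AddEquiv.apply_symm_apply]

lemma ev_d (m : ℕ) (φ : KK q m →ₗ[QSAe k N q] Ag k N q lam) :
    ev q hq0 hq1 hqinv lam (m + 1) (φ ∘ₗ dA q m) =
      cK (h2 (wt q lam)) m (ev q hq0 hq1 hqinv lam m φ) := by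
  funext S
  have h := hom_d (E := QSAe k N q) (theta q) m φ S
  have h' : ev q hq0 hq1 hqinv lam (m + 1) (φ ∘ₗ dA q m) S =
      ag q hq0 hq1 hqinv lam (∑ i ∈ S.1, sg i S.1 • theta q i (S.1.erase i) •
        kExt N (QSAe k N q) (Ag k N q lam) m (fun T => φ (Pi.single T 1)) (S.1.erase i)) := by
    rw [← h]; rfl
  rw [h', map_sum]
  change _ = kH (h2 (wt q lam)) (kExt N k _ m (ev q hq0 hq1 hqinv lam m φ)) S.1
  rw [kH_apply]
  refine Finset.sum_congr rfl fun i hi => ?_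
  have hc : (S.1.erase i).card = m := by
    rw [Finset.card_erase_of_mem hi, S.2]; rfl
  rw [map_zsmul, ag_theta, kExt_apply m _ hc, kExt_apply m _ hc]
  rfl

/-- The goodness condition. -/
abbrev QQ (q : Fin N → Fin N → k) (lam : Fin N → k) (p : (Fin N → ℕ) × Finset (Fin N)) : Prop :=
  ((fun s => ((p.1 s : ℤ))) - betaZ N p.2) ∈ Cg k N q lam

include hq0 hq1 hqinv in
lemma coc_iff (m : ℕ) (φ : KK q m →ₗ[QSAe k N q] Ag k N q lam) :
    φ ∘ₗ dA q m = 0 ↔ cK (h2 (wt q lam)) m (ev q hq0 hq1 hqinv lam m φ) = 0 := by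
  rw [← ev_d]
  constructor
  · intro h; rw [h, ev_zero]
  · intro h
    exact ev_inj hq0 hq1 hqinv lam _ _ _ (h.trans (ev_zero hq0 hq1 hqinv lam _).symm)

lemma fin_surj (m : ℕ) (g : {p : (Fin N → ℕ) × Finset (Fin N) // p.2.card = m ∧ QQ q lam p} →₀ k) :
    ∃ φ : KK q m →ₗ[QSAe k N q] Ag k N q lam, φ ∘ₗ dA q m = 0 ∧
      Pz (QQ q lam) (ev q hq0 hq1 hqinv lam m φ) = g := by
  obtain ⟨z, hz, hQ⟩ := Pz_surj (QQ q lam) g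
  obtain ⟨φ, hφ⟩ := ev_surj hq0 hq1 hqinv lam m z
  refine ⟨φ, ?_, by rw [hφ, hz]⟩
  rw [coc_iff hq0 hq1 hqinv, hφ]
  have := coc2 (wt q lam) (kExt N k _ m z) (by
    intro S a h
    by_cases hS : S.card = m
    · rw [kExt_apply m z hS] at h
      exact (good_iff hq0 hq1 hqinv lam S a).mpr (hQ ⟨S, hS⟩ a h)
    · rw [kExt_apply_ne m z hS] at h
      exact absurd rfl h)
  rw [← kExt_cK] at this
  have h2 := congrArg (kRes N k _ (m + 1)) this
  rwa [kRes_kExt, map_zero] at h2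

lemma fin_ker (m : ℕ) (φ : KK q m →ₗ[QSAe k N q] Ag k N q lam) (hφ : φ ∘ₗ dA q m = 0) :
    Pz (QQ q lam) (ev q hq0 hq1 hqinv lam m φ) = 0 ↔
      IsCob (E := QSAe k N q) (KK q) (dA q) (Ag k N q lam) m φ := by
  rw [coc_iff hq0 hq1 hqinv] at hφ
  constructor
  · intro h
    have hx : kH (h2 (wt q lam)) (kExt N k _ m (ev q hq0 hq1 hqinv lam m φ)) = 0 := by
      rw [← kExt_cK, hφ, map_zero]
    have he := exact2 (wt q lam) _ hx (by
      intro S a hg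
      by_cases hS : S.card = m
      · rw [kExt_apply m _ hS]
        have := DFunLike.congr_fun h
          ⟨((a : Fin N → ℕ), S), hS, (good_iff hq0 hq1 hqinv lam S a).mp hg⟩
        rw [Pz_apply] at this
        simpa using this
      · rw [kExt_apply_ne m _ hS]; rfl)
    have he2 := congrArg (kRes N k _ m) he
    rw [kRes_kExt] at he2
    cases m with
    | zero =>
      change φ = 0
      refine ev_inj hq0 hq1 hqinv lam _ _ _ ?_
      rw [ev_zero, ← he2]
      funext S
      rw [kRes_apply, kH_apply, Finset.card_eq_zero.mp S.2, Finset.sum_empty]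
      rfl
    | succ n =>
      rw [kRes_kH] at he2
      obtain ⟨ψ, hψ⟩ := ev_surj (q := q) hq0 hq1 hqinv lam n
        (kRes N k _ n (kD (f2 (wt q lam)) (kExt N k _ (n + 1) (ev q hq0 hq1 hqinv lam (n + 1) φ))))
      refine ⟨ψ, ev_inj hq0 hq1 hqinv lam _ _ _ ?_⟩
      rw [ev_d, hψ, he2]
  · intro h
    cases m with
    | zero =>
      have h' : φ = 0 := h
      rw [h', ev_zero]
      ext p
      rfl
    | succ n =>
      obtain ⟨ψ, hψ⟩ := h
      ext p
      have hg := (good_iff hq0 hq1 hqinv lam p.1.2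
        (Finsupp.equivFunOnFinite.symm p.1.1)).mpr p.2.2
      have hc := cob2 (wt q lam) (kExt N k _ n (ev q hq0 hq1 hqinv lam n ψ)) _ _ hg
      rw [← kExt_cK, ← ev_d, ← hψ, kExt_apply _ _ p.2.1] at hc
      rw [Pz_apply, hc]
      rfl

lemma fin_add (m : ℕ) (φ ψ : KK q m →ₗ[QSAe k N q] Ag k N q lam) :
    Pz (QQ q lam) (ev q hq0 hq1 hqinv lam m (φ + ψ)) =
      Pz (QQ q lam) (ev q hq0 hq1 hqinv lam m φ) + Pz (QQ q lam) (ev q hq0 hq1 hqinv lam m ψ) := by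
  rw [ev_add]
  ext p
  rfl

lemma fin_smul (m : ℕ) (c : k) (φ ψ : KK q m →ₗ[QSAe k N q] Ag k N q lam)
    (h : ∀ x, ψ x = algebraMap k (QSAe k N q) c • φ x) :
    Pz (QQ q lam) (ev q hq0 hq1 hqinv lam m ψ) =
      c • Pz (QQ q lam) (ev q hq0 hq1 hqinv lam m φ) := by
  have : ev q hq0 hq1 hqinv lam m ψ = c • ev q hq0 hq1 hqinv lam m φ := by
    funext S
    rw [ev, h, ag_smul]
    rfl
  rw [this]
  ext p
  rfl

end Final


/-- Theorem 4.1 of the paper (one group element `g`, acting diagonally with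
`g(x_i) = λ_i x_i`): for every `m`, `HH^m(S_q(V), A_g) = Ext^m_{A^e}(A, A_g)` is
isomorphic as a `k`-vector space to the free `k`-vector space on the set
`{(α, β) ∈ ℕ^N × {0,1}^N : |β| = m, α - β ∈ C_g}`.  (In particular it vanishes for
`m > N`, the index set being empty.) -/
theorem stmt15 (k : Type) [Field k] [CharZero k] (N : ℕ) (hN : 0 < N)
    (q : Fin N → Fin N → k) (hq0 : ∀ i j, q i j ≠ 0) (hq1 : ∀ i, q i i = 1)
    (hqinv : ∀ i j, q j i = (q i j)⁻¹)
    (lam : Fin N → k) (hlam : ∀ i, lam i ≠ 0) (m : ℕ) :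
    Nonempty ((HHg k N q lam m) ≃ₗ[k]
      ({p : (Fin N → ℕ) × Finset (Fin N) //
          p.2.card = m ∧ ((fun s => ((p.1 s : ℤ))) - betaZ N p.2) ∈ Cg k N q lam} →₀ k)) := by
  exact absExt (KK q) (dA q) (res_dd hq0 hq1 hqinv) (epsR q) epsR_surj epsR_d
    (ex0 hq0 hq1 hqinv) (exn hq0 hq1 hqinv) (Ag k N q lam) m
    ({p : (Fin N → ℕ) × Finset (Fin N) // p.2.card = m ∧ QQ q lam p} →₀ k)
    (fun φ => Pz (QQ q lam) (ev q hq0 hq1 hqinv lam m φ))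
    (fin_add hq0 hq1 hqinv lam m) (fin_smul hq0 hq1 hqinv lam m)
    (fin_surj hq0 hq1 hqinv lam m) (fin_ker hq0 hq1 hqinv lam m)
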